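/- arXiv:1706.05507 — 12 statements merged into one kernel-verified Lean document; each statement's English description precedes it below -/
import Mathlib

section
/- Let A and B be real symmetric d×d matrices such that B is positive definite and A − B is positive semidefinite (i.e., A ⪰ B ≻ 0). Then tr(A⁻¹ (A − B)) ≤ log(det A / det B). -/
open Matrix

/-- The matrix form of `log x ≤ x - 1`. -/
theorem Matrix.PosDef.log_det_le_trace_sub_card {n : Type*} [Fintype n] [DecidableEq n]
    {M : Matrix n n ℝ} (hM : M.PosDef) :
    Real.log M.det ≤ M.trace - Fintype.card n := by
  have hdet : M.det = ∏ i, hM.1.eigenvalues i := by simpa using hM.1.det_eq_prod_eigenvalues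
  have htr : M.trace = ∑ i, hM.1.eigenvalues i := by simpa using hM.1.trace_eq_sum_eigenvalues
  rw [hdet, htr, Real.log_prod fun i _ => (hM.eigenvalues_pos i).ne']
  calc ∑ i, Real.log (hM.1.eigenvalues i)
      ≤ ∑ i, (hM.1.eigenvalues i - 1) :=
        Finset.sum_le_sum fun i _ => Real.log_le_sub_one_of_pos (hM.eigenvalues_pos i)
    _ = ∑ i, hM.1.eigenvalues i - Fintype.card n := by simp [Finset.sum_sub_distrib]

open scoped MatrixOrder in
/-- A positive definite matrix has an invertible Hermitian square root. -/
theorem Matrix.PosDef.exists_isHermitian_mul_self_eq {n : Type*} [Fintype n] [DecidableEq n]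
    {M : Matrix n n ℝ} (hM : M.PosDef) :
    ∃ S : Matrix n n ℝ, S.IsHermitian ∧ IsUnit S ∧ S * S = M := by
  have hnonneg : 0 ≤ M := nonneg_iff_posSemidef.2 hM.posSemidef
  have hS : CFC.sqrt M * CFC.sqrt M = M := CFC.sqrt_mul_sqrt_self M hnonneg
  refine ⟨CFC.sqrt M, (nonneg_iff_posSemidef.1 (CFC.sqrt_nonneg M)).isHermitian, ?_, hS⟩
  exact (CFC.isUnit_sqrt_iff M hnonneg).2 hM.isUnit

/-- Lemma 12 of Hazan et al.: if `A ⪰ B ≻ 0` then `tr(A⁻¹ (A − B)) ≤ log(det A / det B)`. -/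
theorem trace_inv_mul_sub_le_log_det_div
    (d : ℕ) (A B : Matrix (Fin d) (Fin d) ℝ)
    (hAsymm : A.IsSymm) (hBsymm : B.IsSymm)
    (hB : B.PosDef) (hAB : (A - B).PosSemidef) :
    (A⁻¹ * (A - B)).trace ≤ Real.log (A.det / B.det) := by
  have hA : A.PosDef := by simpa using hB.add_posSemidef hAB
  obtain ⟨S, hS, hSu, hSS⟩ := hA.inv.exists_isHermitian_mul_self_eq
  have hM : (S * B * S).PosDef := by
    have h := (IsUnit.posDef_star_left_conjugate_iff hSu).2 hB
    rwa [star_eq_conjTranspose, hS.eq] at h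
  have htr : (S * B * S).trace = (A⁻¹ * B).trace := by
    rw [Matrix.trace_mul_comm, ← Matrix.mul_assoc, hSS]
  have hdet : (S * B * S).det = (A.det / B.det)⁻¹ := by
    have h : S.det * S.det = A.det⁻¹ := by
      rw [← det_mul, hSS, det_nonsing_inv, Ring.inverse_eq_inv']
    rw [det_mul, det_mul, mul_right_comm, h, inv_div, div_eq_inv_mul]
  have h := hM.log_det_le_trace_sub_card
  rw [hdet, Real.log_inv, htr, Fintype.card_fin] at h
  rw [Matrix.mul_sub, nonsing_inv_mul _ hA.det_pos.ne'.isUnit, trace_sub, trace_one,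
    Fintype.card_fin]
  linarith
end

section
/- Let d ≥ 1, T ≥ 1, let g_1, …, g_T ∈ ℝ^d, and set v_{t,i} = ∑_{s=1}^t g_{s,i}². Let δ_t ∈ ℝ^d for t = 1, …, T satisfy δ_{t,i} > 0 for all t, i and δ_{t,i} ≤ δ_{t−1,i} for all t ≥ 2 and all i. Then ∑_{t=1}^T ∑_{i=1}^d g_{t,i}² / (v_{t,i} + δ_{t,i}) ≤ ∑_{i=1}^d log((v_{T,i} + δ_{T,i}) / δ_{1,i}) − ∑_{i=1}^d ∑_{t=2}^T (δ_{t,i} − δ_{t−1,i}) / (v_{t,i} + δ_{t,i}). -/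
theorem Real.sub_div_le_log_sub_log {a b : ℝ} (ha : 0 < a) (hb : 0 < b) :
    (a - b) / a ≤ Real.log a - Real.log b := by
  have h := Real.one_sub_inv_le_log_of_pos (div_pos ha hb)
  rwa [inv_div, Real.log_div ha.ne' hb.ne', one_sub_div ha.ne'] at h

/-- The one-coordinate form of the SC-Adagrad summation bound. -/
theorem sum_sq_div_le_log_sub_sum (g δ v : ℕ → ℝ)
    (hv : ∀ t, v t = ∑ s ∈ Finset.Icc 1 t, g s ^ 2) {T : ℕ} (hT : 1 ≤ T)
    (hδ : ∀ t ∈ Finset.Icc 1 T, 0 < δ t) :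
    ∑ t ∈ Finset.Icc 1 T, g t ^ 2 / (v t + δ t)
      ≤ Real.log ((v T + δ T) / δ 1)
        - ∑ t ∈ Finset.Icc 2 T, (δ t - δ (t - 1)) / (v t + δ t) := by
  have hv_nonneg (t : ℕ) : 0 ≤ v t := hv t ▸ Finset.sum_nonneg fun _ _ => sq_nonneg _
  have hpos {t : ℕ} (ht : t ∈ Finset.Icc 1 T) : 0 < v t + δ t :=
    add_pos_of_nonneg_of_pos (hv_nonneg t) (hδ t ht)
  have h1 := hδ 1 (by simp [hT])
  suffices ∀ n, 1 ≤ n → n ≤ T → ∑ t ∈ Finset.Icc 1 n, g t ^ 2 / (v t + δ t)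
      ≤ Real.log (v n + δ n) - Real.log (δ 1)
        - ∑ t ∈ Finset.Icc 2 n, (δ t - δ (t - 1)) / (v t + δ t) by
    rw [Real.log_div (hpos (by simp [hT])).ne' h1.ne']
    exact this T hT le_rfl
  intro n hn
  induction n, hn using Nat.le_induction with
  | base =>
    intro _
    have h := Real.sub_div_le_log_sub_log (hpos (t := 1) (by simp [hT])) h1
    simpa [hv 1] using h
  | succ n hn ih =>
    intro hnT
    have hstep := Real.sub_div_le_log_sub_log
      (hpos (t := n + 1) (by simp [hnT])) (hpos (t := n) (by simp; lia))
    have hsucc : v (n + 1) = v n + g (n + 1) ^ 2 := by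
      rw [hv, hv, Finset.sum_Icc_succ_top (by lia)]
    have hsplit : (v (n + 1) + δ (n + 1) - (v n + δ n)) / (v (n + 1) + δ (n + 1))
        = g (n + 1) ^ 2 / (v (n + 1) + δ (n + 1))
          + (δ (n + 1) - δ n) / (v (n + 1) + δ (n + 1)) := by
      rw [← add_div]
      congr 1
      rw [hsucc]
      ring
    rw [Finset.sum_Icc_succ_top (by lia), Finset.sum_Icc_succ_top (by lia), Nat.add_sub_cancel]
    linarith [ih (by lia)]


/-- SC-Adagrad summation lemma (Lemma 4 in the paper):
`∑_{t=1}^T ⟨g_t, A_t⁻¹ g_t⟩ ≤ ∑_i log((‖g_{1:T,i}‖² + δ_{T,i})/δ_{1,i})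
  − ∑_i ∑_{t=2}^T (δ_{t,i} − δ_{t−1,i})/(‖g_{1:t,i}‖² + δ_{t,i})`. -/
theorem sc_adagrad_sum_lemma
    (d T : ℕ) (hd : 1 ≤ d) (hT : 1 ≤ T)
    (g : ℕ → Fin d → ℝ) (δ : ℕ → Fin d → ℝ)
    (v : ℕ → Fin d → ℝ)
    (hv : ∀ t, ∀ i, v t i = ∑ s ∈ Finset.Icc 1 t, g s i ^ 2)
    (hδpos : ∀ t ∈ Finset.Icc 1 T, ∀ i, 0 < δ t i)
    (hδmono : ∀ t ∈ Finset.Icc 2 T, ∀ i, δ t i ≤ δ (t - 1) i) :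
    ∑ t ∈ Finset.Icc 1 T, ∑ i, g t i ^ 2 / (v t i + δ t i)
      ≤ ∑ i, Real.log ((v T i + δ T i) / δ 1 i)
        - ∑ i, ∑ t ∈ Finset.Icc 2 T, (δ t i - δ (t - 1) i) / (v t i + δ t i) := by
  rw [Finset.sum_comm, ← Finset.sum_sub_distrib]
  exact Finset.sum_le_sum fun i _ => sum_sq_div_le_log_sub_sum (g · i) (δ · i) (v · i)
    (hv · i) hT (hδpos · · i)
end

section
/- Let d ≥ 1, T ≥ 1, C ⊆ ℝ^d convex, μ ∈ ℝ^d with μ_i > 0 for all i, and G_∞, D_∞ > 0. Let f_1, …, f_T : ℝ^d → ℝ, θ* ∈ C, θ_1, …, θ_{T+1} ∈ C and g_1, …, g_T ∈ ℝ^d satisfy: (i) for all t and all y ∈ C, f_t(y) ≥ f_t(θ_t) + ⟨g_t, y − θ_t⟩ + ∑_{i=1}^d μ_i (y_i − θ_{t,i})²; (ii) |g_{t,i}| ≤ G_∞ and |θ_{t,i} − θ*_i| ≤ D_∞ for all t, i. Define v_{t,i} = ∑_{s=1}^t g_{s,i}², let δ_t ∈ ℝ^d satisfy δ_{t,i} >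 0 for all t, i and δ_{t,i} ≤ δ_{t−1,i} for t ≥ 2, and set a_{t,i} = v_{t,i} + δ_{t,i}. Assume α ≥ max_{i} G_∞²/(2 μ_i) and that for each t ∈ {1, …, T}, θ_{t+1} is the weighted projection with respect to a_t onto C of the point with coordinates θ_{t,i} − α g_{t,i}/a_{t,i}. Then ∑_{t=1}^T (f_t(θ_t) − f_t(θ*)) ≤ D_∞² (∑_{i=1}^d δ_{1,i})/(2α) + (α/2) ∑_{i=1}^d log((v_{T,i} + δ_{T,i})/δ_{1,i}) + (1/2) ∑_{i=1}^d [min_{t ∈ {1,…,T}} ((θ_{t,i} − θ*_i)²/α − α/(v_{t,i} + δ_{t,i}))] · (δ_{T,i} − δ_{1,i}). -/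
open Finset in
/-- Telescoping the one-coordinate contributions of weighted gradient steps, where the weights `a`
grow by the squared gradients `γ t ^ 2` and the increments of a non-increasing damping `δ`. -/
lemma sum_weighted_step_le {T : ℕ} {α m : ℝ} (hα : 0 < α) {x γ δ a : ℕ → ℝ}
    (ha_pos : ∀ t ∈ Icc 1 T, 0 < a t) (hδ_pos : 0 < δ 1)
    (hδ : ∀ t ∈ Icc 2 T, δ t ≤ δ (t - 1))
    (ha_one : a 1 = γ 1 ^ 2 + δ 1)
    (ha_succ : ∀ t, 1 ≤ t → a (t + 1) = a t + γ (t + 1) ^ 2 + (δ (t + 1) - δ t))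
    (hm : ∀ t ∈ Icc 1 T, m ≤ x t ^ 2 / α - α / a t) {n : ℕ} (hn : 1 ≤ n) (hnT : n ≤ T) :
    ∑ t ∈ Icc 1 n, ((a t * x t ^ 2 - a t * x (t + 1) ^ 2 - γ t ^ 2 * x t ^ 2) / (2 * α)
        + α / 2 * (γ t ^ 2 / a t))
      ≤ δ 1 * x 1 ^ 2 / (2 * α) + α / 2 * Real.log (a n / δ 1) + 1 / 2 * (m * (δ n - δ 1))
        - a n * x (n + 1) ^ 2 / (2 * α) := by
  induction n, hn using Nat.le_induction with
  | base =>
    have ha := ha_pos 1 (by simp; omega)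
    have hlog := Real.one_sub_inv_le_log_of_pos (div_pos ha hδ_pos)
    have hγ : γ 1 ^ 2 / a 1 = 1 - (a 1 / δ 1)⁻¹ := by
      rw [inv_div, eq_sub_iff_add_eq, ← add_div, ← ha_one, div_self ha.ne']
    have key := mul_le_mul_of_nonneg_left (hγ.trans_le hlog) (half_pos hα).le
    have hx : (a 1 * x 1 ^ 2 - a 1 * x (1 + 1) ^ 2 - γ 1 ^ 2 * x 1 ^ 2) / (2 * α)
        = δ 1 * x 1 ^ 2 / (2 * α) - a 1 * x (1 + 1) ^ 2 / (2 * α) := by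
      rw [ha_one]; ring
    rw [Icc_self, sum_singleton, hx]
    linarith
  | succ n hn ih =>
    have ih := ih (by omega)
    have ha := ha_pos n (by simp; omega)
    have ha' := ha_pos (n + 1) (by simp; omega)
    have hd := hδ (n + 1) (by simp; omega)
    rw [Nat.add_sub_cancel] at hd
    have hlog := Real.one_sub_inv_le_log_of_pos (div_pos ha' ha)
    have hsplit : Real.log (a (n + 1) / δ 1)
        = Real.log (a n / δ 1) + Real.log (a (n + 1) / a n) := by
      rw [Real.log_div ha'.ne' hδ_pos.ne', Real.log_div ha.ne' hδ_pos.ne',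
        Real.log_div ha'.ne' ha.ne']
      ring
    have hγ : γ (n + 1) ^ 2 / a (n + 1)
        = 1 - (a (n + 1) / a n)⁻¹ - (δ (n + 1) - δ n) / a (n + 1) := by
      rw [inv_div]
      field_simp
      linarith [ha_succ n hn]
    have key := mul_le_mul_of_nonneg_left (hγ.trans_le (sub_le_sub_right hlog _)) (half_pos hα).le
    have hmul := mul_le_mul_of_nonpos_right (hm (n + 1) (by simp; omega)) (sub_nonpos.mpr hd)
    have hx : (a (n + 1) * x (n + 1) ^ 2 - a (n + 1) * x (n + 1 + 1) ^ 2
          - γ (n + 1) ^ 2 * x (n + 1) ^ 2) / (2 * α)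
        = a n * x (n + 1) ^ 2 / (2 * α) + 1 / 2 * (x (n + 1) ^ 2 / α * (δ (n + 1) - δ n))
          - a (n + 1) * x (n + 1 + 1) ^ 2 / (2 * α) := by
      rw [show γ (n + 1) ^ 2 = a (n + 1) - a n - (δ (n + 1) - δ n) by linarith [ha_succ n hn]]
      field_simp
      ring
    have hmul' : α / 2 * ((δ (n + 1) - δ n) / a (n + 1))
        = 1 / 2 * (α / a (n + 1) * (δ (n + 1) - δ n)) := by ring
    rw [sum_Icc_succ_top (by omega), hx, hsplit]
    linarith

/-- One step of weighted projected gradient descent: the linearised regret is bounded by the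
decrease of the weighted squared distance to `y` plus the weighted squared gradient norm. -/
lemma sum_grad_mul_le_of_weighted_projection {ι : Type*} [Fintype ι] {α : ℝ} (hα : 0 < α)
    {a g z p y : ι → ℝ} (ha : ∀ i, 0 < a i)
    (hp : ∑ i, a i * ((z i - α * g i / a i) - p i) * (y i - p i) ≤ 0) :
    ∑ i, g i * (z i - y i)
      ≤ ∑ i, ((a i * (z i - y i) ^ 2 - a i * (p i - y i) ^ 2) / (2 * α)
          + α / 2 * (g i ^ 2 / a i)) := by
  have hterm : ∀ i, g i * (z i - y i) ≤
      (a i * (z i - y i) ^ 2 - a i * (p i - y i) ^ 2) / (2 * α) + α / 2 * (g i ^ 2 / a i)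
        + a i * ((z i - α * g i / a i) - p i) * (y i - p i) / α := by
    intro i
    have hi := ha i
    have hsq : (a i * (z i - y i) ^ 2 - a i * (p i - y i) ^ 2) / (2 * α) + α / 2 * (g i ^ 2 / a i)
        + a i * ((z i - α * g i / a i) - p i) * (y i - p i) / α - g i * (z i - y i)
        = a i * (z i - α * g i / a i - p i) ^ 2 / (2 * α) := by
      field_simp
      ring
    have : 0 ≤ a i * (z i - α * g i / a i - p i) ^ 2 / (2 * α) := by positivity
    linarith
  have hsum := Finset.sum_le_sum fun i (_ : i ∈ Finset.univ) => hterm i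
  rw [Finset.sum_add_distrib, ← Finset.sum_div] at hsum
  linarith [div_nonpos_of_nonpos_of_nonneg hp hα.le]


/-- Regret bound for SC-Adagrad with a general element-wise positive, element-wise
non-increasing damping sequence `δ_t` (Theorem 5 in the paper). -/
theorem sc_adagrad_regret
    (d T : ℕ) (hd : 1 ≤ d) (hT : 1 ≤ T)
    (C : Set (Fin d → ℝ)) (hC : Convex ℝ C)
    (μ : Fin d → ℝ) (hμ : ∀ i, 0 < μ i)
    (Ginf Dinf α : ℝ) (hGinf : 0 < Ginf) (hDinf : 0 < Dinf)
    (f : ℕ → (Fin d → ℝ) → ℝ)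
    (θs : Fin d → ℝ) (hθs : θs ∈ C)
    (θ : ℕ → Fin d → ℝ) (hθC : ∀ t ∈ Finset.Icc 1 (T + 1), θ t ∈ C)
    (g : ℕ → Fin d → ℝ)
    (hsc : ∀ t ∈ Finset.Icc 1 T, ∀ y ∈ C,
      f t (θ t) + (∑ i, g t i * (y i - θ t i)) + ∑ i, μ i * (y i - θ t i) ^ 2 ≤ f t y)
    (hgb : ∀ t ∈ Finset.Icc 1 T, ∀ i, |g t i| ≤ Ginf)
    (hθb : ∀ t ∈ Finset.Icc 1 T, ∀ i, |θ t i - θs i| ≤ Dinf)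
    (v : ℕ → Fin d → ℝ) (hv : ∀ t i, v t i = ∑ s ∈ Finset.Icc 1 t, g s i ^ 2)
    (δ : ℕ → Fin d → ℝ)
    (hδpos : ∀ t ∈ Finset.Icc 1 T, ∀ i, 0 < δ t i)
    (hδmono : ∀ t ∈ Finset.Icc 2 T, ∀ i, δ t i ≤ δ (t - 1) i)
    (a : ℕ → Fin d → ℝ) (ha : ∀ t i, a t i = v t i + δ t i)
    (hα : ∀ i, Ginf ^ 2 / (2 * μ i) ≤ α)
    (hproj : ∀ t ∈ Finset.Icc 1 T, ∀ x ∈ C,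
      ∑ i, a t i * ((θ t i - α * g t i / a t i) - θ (t + 1) i) * (x i - θ (t + 1) i) ≤ 0) :
    ∑ t ∈ Finset.Icc 1 T, (f t (θ t) - f t θs)
      ≤ Dinf ^ 2 * (∑ i, δ 1 i) / (2 * α)
        + α / 2 * ∑ i, Real.log ((v T i + δ T i) / δ 1 i)
        + 1 / 2 * ∑ i,
            ((Finset.Icc 1 T).inf' (Finset.nonempty_Icc.mpr hT)
              (fun t => (θ t i - θs i) ^ 2 / α - α / (v t i + δ t i))) * (δ T i - δ 1 i) := by
  have hα_pos : 0 < α :=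
    lt_of_lt_of_le (div_pos (pow_pos hGinf 2) (mul_pos two_pos (hμ ⟨0, hd⟩))) (hα ⟨0, hd⟩)
  have ha_pos : ∀ t ∈ Finset.Icc 1 T, ∀ i, 0 < a t i := fun t ht i => by
    rw [ha, hv]
    exact add_pos_of_nonneg_of_pos (Finset.sum_nonneg fun s _ => sq_nonneg _) (hδpos t ht i)
  have hone : 1 ∈ Finset.Icc 1 T := Finset.mem_Icc.mpr ⟨le_rfl, hT⟩
  have hTmem : T ∈ Finset.Icc 1 T := Finset.mem_Icc.mpr ⟨hT, le_rfl⟩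
  have hstep : ∀ t ∈ Finset.Icc 1 T, f t (θ t) - f t θs ≤ ∑ i,
      ((a t i * (θ t i - θs i) ^ 2 - a t i * (θ (t + 1) i - θs i) ^ 2
          - g t i ^ 2 * (θ t i - θs i) ^ 2) / (2 * α) + α / 2 * (g t i ^ 2 / a t i)) := by
    intro t ht
    have hgrad := sum_grad_mul_le_of_weighted_projection hα_pos (ha_pos t ht) (hproj t ht θs hθs)
    have hlin : ∑ i, g t i * (θs i - θ t i) = -∑ i, g t i * (θ t i - θs i) := by
      rw [← Finset.sum_neg_distrib]
      exact Finset.sum_congr rfl fun i _ => by ring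
    have hcurv : ∑ i, g t i ^ 2 * (θ t i - θs i) ^ 2 / (2 * α)
        ≤ ∑ i, μ i * (θs i - θ t i) ^ 2 := by
      refine Finset.sum_le_sum fun i _ => ?_
      have hg : g t i ^ 2 ≤ Ginf ^ 2 := sq_le_sq.mpr ((hgb t ht i).trans (le_abs_self _))
      have hG := (div_le_iff₀ (mul_pos two_pos (hμ i))).mp (hα i)
      rw [div_le_iff₀ (mul_pos two_pos hα_pos)]
      calc g t i ^ 2 * (θ t i - θs i) ^ 2
          ≤ (α * (2 * μ i)) * (θ t i - θs i) ^ 2 :=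
            mul_le_mul_of_nonneg_right (hg.trans hG) (sq_nonneg _)
        _ = μ i * (θs i - θ t i) ^ 2 * (2 * α) := by ring
    have hfactor : ∑ i,
        ((a t i * (θ t i - θs i) ^ 2 - a t i * (θ (t + 1) i - θs i) ^ 2
            - g t i ^ 2 * (θ t i - θs i) ^ 2) / (2 * α) + α / 2 * (g t i ^ 2 / a t i))
        = ∑ i, ((a t i * (θ t i - θs i) ^ 2 - a t i * (θ (t + 1) i - θs i) ^ 2) / (2 * α)
            + α / 2 * (g t i ^ 2 / a t i))
          - ∑ i, g t i ^ 2 * (θ t i - θs i) ^ 2 / (2 * α) := by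
      rw [← Finset.sum_sub_distrib]
      exact Finset.sum_congr rfl fun i _ => by ring
    linarith [hsc t ht θs hθs]
  refine (Finset.sum_le_sum hstep).trans ?_
  rw [Finset.sum_comm, Finset.mul_sum, Finset.sum_div, Finset.mul_sum, Finset.mul_sum,
    ← Finset.sum_add_distrib, ← Finset.sum_add_distrib]
  refine Finset.sum_le_sum fun i _ => ?_
  have hcoord := sum_weighted_step_le (T := T) (n := T)
    (m := (Finset.Icc 1 T).inf' (Finset.nonempty_Icc.mpr hT)
      (fun t => (θ t i - θs i) ^ 2 / α - α / (v t i + δ t i)))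
    (x := fun t => θ t i - θs i) (γ := fun t => g t i) (δ := fun t => δ t i) (a := fun t => a t i)
    hα_pos (fun t ht => ha_pos t ht i) (hδpos 1 hone i) (fun t ht => hδmono t ht i)
    (by simp [ha, hv])
    (fun t _ => by simp only [ha, hv, Finset.sum_Icc_succ_top (Nat.le_add_left 1 t)]; ring)
    (fun t ht => by rw [ha]; exact Finset.inf'_le _ ht) hT le_rfl
  have hlast : 0 ≤ a T i * (θ (T + 1) i - θs i) ^ 2 / (2 * α) :=
    div_nonneg (mul_nonneg (ha_pos T hTmem i).le (sq_nonneg _)) (by positivity)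
  have hinit : δ 1 i * (θ 1 i - θs i) ^ 2 / (2 * α) ≤ Dinf ^ 2 * δ 1 i / (2 * α) := by
    rw [mul_comm (Dinf ^ 2)]
    have hD : (θ 1 i - θs i) ^ 2 ≤ Dinf ^ 2 :=
      sq_le_sq.mpr ((hθb 1 hone i).trans (le_abs_self _))
    have := hδpos 1 hone i
    gcongr
  rw [← ha T i]
  linarith
end

section
/- Let d ≥ 1, T ≥ 1, C ⊆ ℝ^d convex, μ ∈ ℝ^d with μ_i > 0 for all i, and G_∞, D_∞ > 0, δ > 0. Let f_1, …, f_T : ℝ^d → ℝ, θ* ∈ C, θ_1, …, θ_{T+1} ∈ C and g_1, …, g_T ∈ ℝ^d satisfy: (i) for all t and all y ∈ C, f_t(y) ≥ f_t(θ_t) + ⟨g_t, y − θ_t⟩ + ∑_{i=1}^d μ_i (y_i − θ_{t,i})²; (ii) |g_{t,i}| ≤ G_∞ and |θ_{t,i} − θ*_i| ≤ D_∞ for all t, i. Define v_{t,i} = ∑_{s=1}^t g_{s,i}² and a_{t,i} = v_{t,i} + δ. Assume α ≥ max_i G_∞²/(2 μ_i) and that for each t ∈ {1, …, T}, θ_{t+1}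 is the weighted projection with respect to a_t onto C of the point with coordinates θ_{t,i} − α g_{t,i}/a_{t,i}. Then ∑_{t=1}^T (f_t(θ_t) − f_t(θ*)) ≤ d D_∞² δ/(2α) + (α/2) ∑_{i=1}^d log((v_{T,i} + δ)/δ). -/
/-- One coordinate of one step of a preconditioned gradient update: the weight grows from `b` to
`b + g ^ 2`, and the iterate moves from `x` to `y`, with comparator `s`. -/
theorem adagrad_coordinate_step {α b g m s x y : ℝ} (hα : 0 < α) (hb : 0 < b)
    (hm : g ^ 2 ≤ 2 * α * m) :
    g * (x - s) - m * (x - s) ^ 2 ≤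
      (b * (x - s) ^ 2 - (b + g ^ 2) * (y - s) ^ 2) / (2 * α)
        + α / 2 * (Real.log (b + g ^ 2) - Real.log b)
        + (b + g ^ 2) * ((x - α * g / (b + g ^ 2)) - y) * (s - y) / α := by
  have ha : 0 < b + g ^ 2 := by positivity
  have hlog : g ^ 2 / (b + g ^ 2) ≤ Real.log (b + g ^ 2) - Real.log b := by
    have h := Real.one_sub_inv_le_log_of_pos (div_pos ha hb)
    rw [Real.log_div ha.ne' hb.ne'] at h
    refine le_trans (le_of_eq ?_) h
    field_simp
    ring
  have hm' : g ^ 2 * (x - s) ^ 2 / (2 * α) ≤ m * (x - s) ^ 2 := by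
    rw [div_le_iff₀ (by positivity)]
    nlinarith [mul_le_mul_of_nonneg_right hm (sq_nonneg (x - s))]
  have hlog' := mul_le_mul_of_nonneg_left hlog (half_pos hα).le
  have hu : 0 ≤ (b + g ^ 2) * ((x - α * g / (b + g ^ 2)) - y) ^ 2 / (2 * α) := by positivity
  have key : (b + g ^ 2) * ((x - α * g / (b + g ^ 2)) - y) * (s - y) / α
      = (b + g ^ 2) * ((x - α * g / (b + g ^ 2)) - y) ^ 2 / (2 * α)
        + (b + g ^ 2) * (y - s) ^ 2 / (2 * α) - b * (x - s) ^ 2 / (2 * α)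
        - g ^ 2 * (x - s) ^ 2 / (2 * α) + g * (x - s) - α / 2 * (g ^ 2 / (b + g ^ 2)) := by
    field_simp
    ring
  rw [key, sub_div]
  linarith

/-- Regret bound for SC-Adagrad with a constant damping factor `δ` (second part of
Theorem 5 in the paper): `R(T) ≤ d D_∞² δ/(2α) + (α/2) ∑_i log((‖g_{1:T,i}‖² + δ)/δ)`. -/
theorem sc_adagrad_regret_const_damping
    (d T : ℕ) (hd : 1 ≤ d) (hT : 1 ≤ T)
    (C : Set (Fin d → ℝ)) (hC : Convex ℝ C)
    (μ : Fin d → ℝ) (hμ : ∀ i, 0 < μ i)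
    (Ginf Dinf α δ : ℝ) (hGinf : 0 < Ginf) (hDinf : 0 < Dinf) (hδ : 0 < δ)
    (f : ℕ → (Fin d → ℝ) → ℝ)
    (θs : Fin d → ℝ) (hθs : θs ∈ C)
    (θ : ℕ → Fin d → ℝ) (hθC : ∀ t ∈ Finset.Icc 1 (T + 1), θ t ∈ C)
    (g : ℕ → Fin d → ℝ)
    (hsc : ∀ t ∈ Finset.Icc 1 T, ∀ y ∈ C,
      f t (θ t) + (∑ i, g t i * (y i - θ t i)) + ∑ i, μ i * (y i - θ t i) ^ 2 ≤ f t y)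
    (hgb : ∀ t ∈ Finset.Icc 1 T, ∀ i, |g t i| ≤ Ginf)
    (hθb : ∀ t ∈ Finset.Icc 1 T, ∀ i, |θ t i - θs i| ≤ Dinf)
    (v : ℕ → Fin d → ℝ) (hv : ∀ t i, v t i = ∑ s ∈ Finset.Icc 1 t, g s i ^ 2)
    (a : ℕ → Fin d → ℝ) (ha : ∀ t i, a t i = v t i + δ)
    (hα : ∀ i, Ginf ^ 2 / (2 * μ i) ≤ α)
    (hproj : ∀ t ∈ Finset.Icc 1 T, ∀ x ∈ C,
      ∑ i, a t i * ((θ t i - α * g t i / a t i) - θ (t + 1) i) * (x i - θ (t + 1) i) ≤ 0) :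
    ∑ t ∈ Finset.Icc 1 T, (f t (θ t) - f t θs)
      ≤ (d : ℝ) * Dinf ^ 2 * δ / (2 * α)
        + α / 2 * ∑ i, Real.log ((v T i + δ) / δ) := by
  have hαpos : 0 < α :=
    lt_of_lt_of_le (div_pos (by positivity) (mul_pos two_pos (hμ _))) (hα ⟨0, hd⟩)
  have ha_pos : ∀ t i, 0 < a t i := fun t i => by
    rw [ha, hv]
    exact add_pos_of_nonneg_of_pos (Finset.sum_nonneg fun s _ => sq_nonneg _) hδ
  have ha_zero : ∀ i, a 0 i = δ := fun i => by simp [ha, hv]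
  have ha_succ : ∀ t i, a (t + 1) i = a t i + g (t + 1) i ^ 2 := fun t i => by
    rw [ha, ha, hv, hv, Finset.sum_Icc_succ_top (by omega)]
    ring
  have step : ∀ t, t + 1 ≤ T → f (t + 1) (θ (t + 1)) - f (t + 1) θs ≤
      ∑ i, ((a t i * (θ (t + 1) i - θs i) ^ 2
          - a (t + 1) i * (θ (t + 1 + 1) i - θs i) ^ 2) / (2 * α)
        + α / 2 * (Real.log (a (t + 1) i) - Real.log (a t i))) := by
    intro t ht
    have hmem : t + 1 ∈ Finset.Icc 1 T := Finset.mem_Icc.2 ⟨by omega, ht⟩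
    have hf := hsc _ hmem θs hθs
    have hp := div_nonpos_of_nonpos_of_nonneg (hproj _ hmem θs hθs) hαpos.le
    have hsum := Finset.sum_le_sum fun i (_ : i ∈ Finset.univ) =>
      adagrad_coordinate_step (s := θs i) (x := θ (t + 1) i) (y := θ (t + 1 + 1) i)
        (m := μ i) (g := g (t + 1) i) hαpos (ha_pos t i) (by
          have h1 := (div_le_iff₀ (mul_pos two_pos (hμ i))).1 (hα i)
          have h2 := sq_le_sq' (neg_le_of_abs_le (hgb _ hmem i)) (le_of_abs_le (hgb _ hmem i))
          linarith)
    simp only [← ha_succ] at hsum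
    rw [Finset.sum_add_distrib, ← Finset.sum_div Finset.univ (fun i => a (t + 1) i *
      ((θ (t + 1) i - α * g (t + 1) i / a (t + 1) i) - θ (t + 1 + 1) i)
        * (θs i - θ (t + 1 + 1) i)) α] at hsum
    have hlin : ∑ i, (g (t + 1) i * (θ (t + 1) i - θs i) - μ i * (θ (t + 1) i - θs i) ^ 2)
        = -(∑ i, g (t + 1) i * (θs i - θ (t + 1) i))
          - ∑ i, μ i * (θs i - θ (t + 1) i) ^ 2 := by
      rw [← Finset.sum_neg_distrib, ← Finset.sum_sub_distrib]
      exact Finset.sum_congr rfl fun i _ => by ring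
    linarith
  have telescope : ∀ n ≤ T, ∑ t ∈ Finset.Icc 1 n, (f t (θ t) - f t θs) ≤
      ∑ i, ((δ * (θ 1 i - θs i) ^ 2 - a n i * (θ (n + 1) i - θs i) ^ 2) / (2 * α)
        + α / 2 * (Real.log (a n i) - Real.log δ)) := by
    intro n
    induction n with
    | zero => intro _; simp [ha_zero]
    | succ n ih =>
      intro hn
      rw [Finset.sum_Icc_succ_top (by omega)]
      refine (add_le_add (ih (by omega)) (step n hn)).trans (le_of_eq ?_)
      rw [← Finset.sum_add_distrib]
      exact Finset.sum_congr rfl fun i _ => by ring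
  have hconst : (d : ℝ) * Dinf ^ 2 * δ / (2 * α) = ∑ _i : Fin d, δ * Dinf ^ 2 / (2 * α) := by
    rw [Finset.sum_const, Finset.card_univ, Fintype.card_fin, nsmul_eq_mul]
    ring
  refine (telescope T le_rfl).trans ?_
  rw [hconst, Finset.mul_sum, ← Finset.sum_add_distrib]
  refine Finset.sum_le_sum fun i _ => ?_
  rw [← ha, Real.log_div (ha_pos T i).ne' hδ.ne']
  have hb := hθb 1 (Finset.mem_Icc.2 ⟨le_rfl, hT⟩) i
  have hD : (θ 1 i - θs i) ^ 2 ≤ Dinf ^ 2 :=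
    sq_le_sq' (neg_le_of_abs_le hb) (le_of_abs_le hb)
  have hlast : 0 ≤ a T i * (θ (T + 1) i - θs i) ^ 2 :=
    mul_nonneg (ha_pos T i).le (sq_nonneg _)
  gcongr
  linarith [mul_le_mul_of_nonneg_left hD hδ.le]
end

section
/- Let d ≥ 1, T ≥ 1, C ⊆ ℝ^d convex, μ ∈ ℝ^d with μ_i > 0 for all i, and G_∞, D_∞ > 0. Let ξ_1 > 0, ξ_2 > 0 with log(ξ_1 ξ_2) + 1 > 0. Let f_1, …, f_T : ℝ^d → ℝ, θ* ∈ C, θ_1, …, θ_{T+1} ∈ C and g_1, …, g_T ∈ ℝ^d satisfy: (i) for all t and all y ∈ C, f_t(y) ≥ f_t(θ_t) + ⟨g_t, y − θ_t⟩ + ∑_{i=1}^d μ_i (y_i − θ_{t,i})²; (ii) |g_{t,i}| ≤ G_∞ and |θ_{t,i} − θ*_i| ≤ D_∞ for all t, i. Define v_{t,i} = ∑_{s=1}^t g_{s,i}², δ_{t,i} = ξ_2 e^{−ξ_1 v_{t,i}} and a_{t,i} = v_{t,i} + δ_{t,i}. Assume α ≥ max_i G_∞²/(2 μ_i) and that for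 each t ∈ {1, …, T}, θ_{t+1} is the weighted projection with respect to a_t onto C of the point with coordinates θ_{t,i} − α g_{t,i}/a_{t,i}. Then ∑_{t=1}^T (f_t(θ_t) − f_t(θ*)) ≤ d D_∞² ξ_2/(2α) − (α d/2) log(ξ_2 e^{−ξ_1 G_∞²}) + (α/2) ∑_{i=1}^d log(v_{T,i} + ξ_2 e^{−ξ_1 v_{T,i}}) + (α ξ_1 ξ_2 / (2 (log(ξ_1 ξ_2) + 1))) ∑_{i=1}^d (1 − e^{−ξ_1 v_{T,i}}). -/
/-- The damped accumulator `v + ξ₂ e^{−ξ₁ v}` is bounded below by its minimum over `v`. -/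
lemma log_add_one_div_le_add_mul_exp {ξ1 ξ2 : ℝ} (hξ1 : 0 < ξ1) (hξ2 : 0 < ξ2) (v : ℝ) :
    (Real.log (ξ1 * ξ2) + 1) / ξ1 ≤ v + ξ2 * Real.exp (-(ξ1 * v)) := by
  rw [div_le_iff₀ hξ1]
  have h := Real.add_one_le_exp (Real.log (ξ1 * ξ2) + -(ξ1 * v))
  rw [Real.exp_add, Real.exp_log (by positivity)] at h
  linarith

/-- A relative increment `(c - b + e) / c` is at most the logarithmic increment from `b` to `c` plus
`e / m`, where `m` is a positive lower bound for `c`. -/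
lemma div_le_log_sub_log_add {b c e m : ℝ} (hb : 0 < b) (hm : 0 < m) (hmc : m ≤ c)
    (he : 0 ≤ e) :
    (c - b + e) / c ≤ Real.log c - Real.log b + e / m := by
  have hc : 0 < c := hm.trans_le hmc
  have h1 := Real.log_le_sub_one_of_pos (div_pos hb hc)
  rw [Real.log_div hb.ne' hc.ne'] at h1
  have h2 : e / c ≤ e / m := by gcongr
  have h3 : (c - b + e) / c = 1 - b / c + e / c := by
    field_simp
  linarith

/-- Per-coordinate form of the descent inequality for a weighted gradient step. -/
lemma mul_sub_le_weighted_step {a α g x y z : ℝ} (ha : 0 < a) (hα : 0 < α) :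
    g * (x - z) ≤ a * (x - z) ^ 2 / (2 * α) - a * (y - z) ^ 2 / (2 * α) + α / 2 * (g ^ 2 / a)
      + a * ((x - α * g / a) - y) * (z - y) / α := by
  have key : a * (x - z) ^ 2 / (2 * α) - a * (y - z) ^ 2 / (2 * α) + α / 2 * (g ^ 2 / a)
      + a * ((x - α * g / a) - y) * (z - y) / α - g * (x - z)
      = (a * (x - y) - α * g) ^ 2 / (2 * α * a) := by
    field_simp
    ring
  have : 0 ≤ (a * (x - y) - α * g) ^ 2 / (2 * α * a) := by positivity
  linarith


/-- Regret bound for SC-Adagrad with the exponential damping decay scheme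
`δ_{t,i} = ξ₂ e^{−ξ₁ v_{t,i}}` (Corollary 6 in the paper). -/
theorem sc_adagrad_regret_exp_damping
    (d T : ℕ) (hd : 1 ≤ d) (hT : 1 ≤ T)
    (C : Set (Fin d → ℝ)) (hC : Convex ℝ C)
    (μ : Fin d → ℝ) (hμ : ∀ i, 0 < μ i)
    (Ginf Dinf α ξ1 ξ2 : ℝ) (hGinf : 0 < Ginf) (hDinf : 0 < Dinf)
    (hξ1 : 0 < ξ1) (hξ2 : 0 < ξ2) (hlog : 0 < Real.log (ξ1 * ξ2) + 1)
    (f : ℕ → (Fin d → ℝ) → ℝ)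
    (θs : Fin d → ℝ) (hθs : θs ∈ C)
    (θ : ℕ → Fin d → ℝ) (hθC : ∀ t ∈ Finset.Icc 1 (T + 1), θ t ∈ C)
    (g : ℕ → Fin d → ℝ)
    (hsc : ∀ t ∈ Finset.Icc 1 T, ∀ y ∈ C,
      f t (θ t) + (∑ i, g t i * (y i - θ t i)) + ∑ i, μ i * (y i - θ t i) ^ 2 ≤ f t y)
    (hgb : ∀ t ∈ Finset.Icc 1 T, ∀ i, |g t i| ≤ Ginf)
    (hθb : ∀ t ∈ Finset.Icc 1 T, ∀ i, |θ t i - θs i| ≤ Dinf)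
    (v : ℕ → Fin d → ℝ) (hv : ∀ t i, v t i = ∑ s ∈ Finset.Icc 1 t, g s i ^ 2)
    (δ : ℕ → Fin d → ℝ) (hδ : ∀ t i, δ t i = ξ2 * Real.exp (-(ξ1 * v t i)))
    (a : ℕ → Fin d → ℝ) (ha : ∀ t i, a t i = v t i + δ t i)
    (hα : ∀ i, Ginf ^ 2 / (2 * μ i) ≤ α)
    (hproj : ∀ t ∈ Finset.Icc 1 T, ∀ x ∈ C,
      ∑ i, a t i * ((θ t i - α * g t i / a t i) - θ (t + 1) i) * (x i - θ (t + 1) i) ≤ 0) :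
    ∑ t ∈ Finset.Icc 1 T, (f t (θ t) - f t θs)
      ≤ (d : ℝ) * Dinf ^ 2 * ξ2 / (2 * α)
        - α * (d : ℝ) / 2 * Real.log (ξ2 * Real.exp (-(ξ1 * Ginf ^ 2)))
        + α / 2 * ∑ i, Real.log (v T i + ξ2 * Real.exp (-(ξ1 * v T i)))
        + α * ξ1 * ξ2 / (2 * (Real.log (ξ1 * ξ2) + 1))
            * ∑ i, (1 - Real.exp (-(ξ1 * v T i))) := by
  have hαpos : 0 < α :=
    lt_of_lt_of_le (by have := hμ ⟨0, hd⟩; positivity) (hα ⟨0, hd⟩)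
  set m := (Real.log (ξ1 * ξ2) + 1) / ξ1 with hm
  have hmpos : 0 < m := div_pos hlog hξ1
  have ham : ∀ t i, m ≤ a t i := fun t i => by
    rw [ha, hδ]; exact log_add_one_div_le_add_mul_exp hξ1 hξ2 _
  have hapos : ∀ t i, 0 < a t i := fun t i => hmpos.trans_le (ham t i)
  have hv0 : ∀ i, v 0 i = 0 := fun i => by simp [hv]
  have hvs : ∀ t i, v (t + 1) i = v t i + g (t + 1) i ^ 2 := fun t i => by
    rw [hv, hv, Finset.sum_Icc_succ_top (by omega)]
  have hδs : ∀ t i, δ (t + 1) i ≤ δ t i := fun t i => by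
    rw [hδ, hδ, hvs]
    gcongr
    nlinarith [sq_nonneg (g (t + 1) i)]
  let Φ : ℕ → Fin d → ℝ := fun t i =>
    a t i * (θ (t + 1) i - θs i) ^ 2 / (2 * α) - α / 2 * Real.log (a t i) + α / 2 * (δ t i / m)
  have hcoord : ∀ t, t + 1 ∈ Finset.Icc 1 T → ∀ i,
      g (t + 1) i * (θ (t + 1) i - θs i) - μ i * (θ (t + 1) i - θs i) ^ 2
        ≤ Φ t i - Φ (t + 1) i + a (t + 1) i *
          ((θ (t + 1) i - α * g (t + 1) i / a (t + 1) i) - θ (t + 1 + 1) i)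
            * (θs i - θ (t + 1 + 1) i) / α := by
    intro t ht i
    have hstep := mul_sub_le_weighted_step (g := g (t + 1) i) (x := θ (t + 1) i)
      (y := θ (t + 1 + 1) i) (z := θs i) (hapos (t + 1) i) hαpos
    have hl := div_le_log_sub_log_add (e := δ t i - δ (t + 1) i) (hapos t i) hmpos
      (ham (t + 1) i) (sub_nonneg.2 (hδs t i))
    have hq : a (t + 1) i - a t i + (δ t i - δ (t + 1) i) = g (t + 1) i ^ 2 := by
      rw [ha, ha, hvs]; ring
    rw [hq, sub_div] at hl
    have hl' := mul_le_mul_of_nonneg_left hl (by positivity : 0 ≤ α / 2)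
    have hg : g (t + 1) i ^ 2 ≤ Ginf ^ 2 := sq_le_sq.2 (by
      rw [abs_of_pos hGinf]; exact hgb _ ht i)
    have hαi := hα i
    rw [div_le_iff₀ (by have := hμ i; positivity)] at hαi
    have hinc : (a (t + 1) i - a t i) / (2 * α) ≤ μ i := by
      rw [div_le_iff₀ (by positivity)]
      linarith [hδs t i]
    have hx := mul_le_mul_of_nonneg_right hinc (sq_nonneg (θ (t + 1) i - θs i))
    have hx' : (a (t + 1) i - a t i) / (2 * α) * (θ (t + 1) i - θs i) ^ 2
        = a (t + 1) i * (θ (t + 1) i - θs i) ^ 2 / (2 * α)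
          - a t i * (θ (t + 1) i - θs i) ^ 2 / (2 * α) := by ring
    simp only [Φ]
    linarith
  have hround : ∀ t ∈ Finset.range T,
      f (t + 1) (θ (t + 1)) - f (t + 1) θs ≤ ∑ i, Φ t i - ∑ i, Φ (t + 1) i := by
    intro t ht
    have ht' : t + 1 ∈ Finset.Icc 1 T := by simp at ht ⊢; omega
    have h1 := hsc _ ht' θs hθs
    have h2 := Finset.sum_le_sum fun i (_ : i ∈ Finset.univ) => hcoord t ht' i
    have h3 := div_nonpos_of_nonpos_of_nonneg (hproj _ ht' θs hθs) hαpos.le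
    rw [Finset.sum_div] at h3
    rw [Finset.sum_add_distrib, Finset.sum_sub_distrib, Finset.sum_sub_distrib] at h2
    have h4 : ∑ i, g (t + 1) i * (θs i - θ (t + 1) i)
        = -∑ i, g (t + 1) i * (θ (t + 1) i - θs i) := by
      rw [← Finset.sum_neg_distrib]
      exact Finset.sum_congr rfl fun i _ => by ring
    have h5 : ∑ i, μ i * (θs i - θ (t + 1) i) ^ 2
        = ∑ i, μ i * (θ (t + 1) i - θs i) ^ 2 :=
      Finset.sum_congr rfl fun i _ => by ring
    linarith
  have htel : ∑ t ∈ Finset.Icc 1 T, (f t (θ t) - f t θs) ≤ ∑ i, (Φ 0 i - Φ T i) := by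
    rw [Finset.sum_sub_distrib (Φ 0) (Φ T), ← Finset.sum_range_sub' (fun t => ∑ i, Φ t i) T,
      ← Finset.Ico_add_one_right_eq_Icc, Finset.sum_Ico_eq_sum_range]
    simpa only [add_comm 1, Nat.add_sub_cancel] using Finset.sum_le_sum hround
  have hfin : ∀ i, Φ 0 i - Φ T i ≤ Dinf ^ 2 * ξ2 / (2 * α)
      - α / 2 * Real.log (ξ2 * Real.exp (-(ξ1 * Ginf ^ 2)))
      + α / 2 * Real.log (v T i + ξ2 * Real.exp (-(ξ1 * v T i)))
      + α * ξ1 * ξ2 / (2 * (Real.log (ξ1 * ξ2) + 1)) * (1 - Real.exp (-(ξ1 * v T i))) := by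
    intro i
    have hδ0 : δ 0 i = ξ2 := by simp [hδ, hv0]
    have ha0 : a 0 i = ξ2 := by simp [ha, hv0, hδ0]
    have hsq : (θ 1 i - θs i) ^ 2 ≤ Dinf ^ 2 := sq_le_sq.2 (by
      rw [abs_of_pos hDinf]; exact hθb 1 (by simp [hT]) i)
    have h1 : ξ2 * (θ 1 i - θs i) ^ 2 / (2 * α) ≤ Dinf ^ 2 * ξ2 / (2 * α) := by
      rw [mul_comm (Dinf ^ 2)]; gcongr
    have h2 : 0 ≤ a T i * (θ (T + 1) i - θs i) ^ 2 / (2 * α) := by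
      have := hapos T i
      positivity
    have h3 : Real.log (ξ2 * Real.exp (-(ξ1 * Ginf ^ 2))) ≤ Real.log ξ2 := by
      rw [Real.log_mul hξ2.ne' (Real.exp_pos _).ne', Real.log_exp]
      have : 0 ≤ ξ1 * Ginf ^ 2 := by positivity
      linarith
    have h4 := mul_le_mul_of_nonneg_left h3 (by positivity : 0 ≤ α / 2)
    have h5 : α / 2 * (ξ2 / m) - α / 2 * (δ T i / m)
        = α * ξ1 * ξ2 / (2 * (Real.log (ξ1 * ξ2) + 1)) * (1 - Real.exp (-(ξ1 * v T i))) := by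
      rw [hδ, hm]
      have := hlog.ne'
      field_simp
    have h6 : v T i + ξ2 * Real.exp (-(ξ1 * v T i)) = a T i := by rw [ha, hδ]
    rw [h6, ← h5]
    simp only [Φ, zero_add, ha0, hδ0]
    linarith
  refine (htel.trans (Finset.sum_le_sum fun i _ => hfin i)).trans_eq ?_
  simp only [Finset.sum_add_distrib, ← Finset.mul_sum, Finset.sum_const,
    Finset.card_univ, Fintype.card_fin, nsmul_eq_mul]
  ring
end

section
/- Let 0 < γ ≤ 1 and T ≥ 1. Let g_1, …, g_T ∈ ℝ and let (β_t) satisfy 1 − 1/t ≤ β_t ≤ 1 − γ/t for all t ≥ 1. Define v_0 = 0 and v_t = β_t v_{t−1} + (1 − β_t) g_t². Let ε_t > 0 satisfy √(t−1) ε_{t−1} ≤ √t ε_t for all t ≥ 2. Then ∑_{t=1}^T g_t² / (√(t v_t) + √t ε_t) ≤ (2(2 − γ)/γ) (√(T v_T) + √T ε_T). -/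
/-- If `γ x ≤ S² - R²`, then `x / (S + E)` is at most `2 / γ` times the increment
`S - R`. -/
theorem div_add_le_two_div_mul_sub {x S R E γ : ℝ} (hγ : 0 < γ) (hx : 0 ≤ x) (hS : 0 ≤ S)
    (hE : 0 < E) (h : γ * x ≤ S ^ 2 - R ^ 2) :
    x / (S + E) ≤ 2 / γ * (S - R) := by
  have hle : R ≤ S := by
    have := mul_nonneg hγ.le hx
    exact abs_le_of_sq_le_sq' (by linarith) hS |>.2
  rw [div_le_iff₀ (by positivity), div_mul_eq_mul_div, div_mul_eq_mul_div, le_div_iff₀ hγ]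
  nlinarith [mul_nonneg (sub_nonneg.2 hle) (sub_nonneg.2 hle), mul_nonneg (sub_nonneg.2 hle) hE.le]

/-- The running average of squares with decay parameter `b ∈ [1 - 1/t, 1 - γ/t]` grows by at least
`γ x` after rescaling by time. -/
theorem mul_le_rescaled_average_increment {t γ b w x : ℝ} (ht : 0 < t) (hb : 1 - 1 / t ≤ b)
    (hb' : b ≤ 1 - γ / t) (hw : 0 ≤ w) (hx : 0 ≤ x) :
    γ * x ≤ t * (b * w + (1 - b) * x) - (t - 1) * w := by
  have h1 : t - 1 ≤ t * b := by
    have := mul_le_mul_of_nonneg_left hb ht.le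
    rwa [mul_sub, mul_one, mul_one_div_cancel ht.ne'] at this
  have h2 : t * b ≤ t - γ := by
    have := mul_le_mul_of_nonneg_left hb' ht.le
    rwa [mul_sub, mul_one, mul_div_cancel₀ _ ht.ne'] at this
  nlinarith [mul_nonneg (sub_nonneg.2 h1) hw, mul_nonneg (sub_nonneg.2 h2) hx]

/-- The key per-coordinate summation inequality for RMSProp (Lemma 7 in the paper):
`∑_{t=1}^T g_t²/(√(t v_t) + √t ε_t) ≤ (2(2−γ)/γ)(√(T v_T) + √T ε_T)`. -/
theorem rmsprop_sum_lemma
    (T : ℕ) (hT : 1 ≤ T) (γ : ℝ) (hγ0 : 0 < γ) (hγ1 : γ ≤ 1)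
    (g β : ℕ → ℝ)
    (hβ : ∀ t : ℕ, 1 ≤ t → 1 - 1 / (t : ℝ) ≤ β t ∧ β t ≤ 1 - γ / (t : ℝ))
    (v : ℕ → ℝ) (hv0 : v 0 = 0)
    (hv : ∀ t : ℕ, 1 ≤ t → v t = β t * v (t - 1) + (1 - β t) * g t ^ 2)
    (ε : ℕ → ℝ) (hε : ∀ t : ℕ, 1 ≤ t → 0 < ε t)
    (hεmono : ∀ t : ℕ, 2 ≤ t → Real.sqrt ((t : ℝ) - 1) * ε (t - 1) ≤ Real.sqrt (t : ℝ) * ε t) :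
    ∑ t ∈ Finset.Icc 1 T, g t ^ 2 / (Real.sqrt ((t : ℝ) * v t) + Real.sqrt (t : ℝ) * ε t)
      ≤ (2 * (2 - γ) / γ) * (Real.sqrt ((T : ℝ) * v T) + Real.sqrt (T : ℝ) * ε T) := by
  have hv_nonneg : ∀ t, 0 ≤ v t := by
    intro t
    induction t with
    | zero => exact hv0.ge
    | succ n ih =>
      obtain ⟨hl, hu⟩ := hβ (n + 1) n.succ_pos
      rw [hv (n + 1) n.succ_pos, Nat.add_sub_cancel]
      have hn : (1 : ℝ) ≤ ((n + 1 : ℕ) : ℝ) := by exact_mod_cast n.succ_pos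
      have hinv : 1 / ((n + 1 : ℕ) : ℝ) ≤ 1 := (div_le_one (by linarith)).2 hn
      have hγn : 0 ≤ γ / ((n + 1 : ℕ) : ℝ) := by positivity
      exact add_nonneg (mul_nonneg (by linarith) ih) (mul_nonneg (by linarith) (sq_nonneg _))
  clear hT
  induction T with
  | zero => simp
  | succ n ih =>
    rw [Finset.sum_Icc_succ_top (by omega)]
    obtain ⟨hl, hu⟩ := hβ (n + 1) n.succ_pos
    have hn : (0 : ℝ) < ((n + 1 : ℕ) : ℝ) := by positivity
    have hE : 0 < √((n + 1 : ℕ) : ℝ) * ε (n + 1) :=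
      mul_pos (Real.sqrt_pos.2 hn) (hε _ n.succ_pos)
    have hEmono : √(n : ℝ) * ε n ≤ √((n + 1 : ℕ) : ℝ) * ε (n + 1) := by
      rcases n.eq_zero_or_pos with rfl | hpos
      · simpa using hE.le
      · simpa using hεmono (n + 1) (by omega)
    have hgrow : γ * g (n + 1) ^ 2 ≤
        √(((n + 1 : ℕ) : ℝ) * v (n + 1)) ^ 2 - √((n : ℝ) * v n) ^ 2 := by
      rw [Real.sq_sqrt (mul_nonneg hn.le (hv_nonneg _)),
        Real.sq_sqrt (mul_nonneg n.cast_nonneg (hv_nonneg n)), hv (n + 1) n.succ_pos,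
        Nat.add_sub_cancel]
      simpa using mul_le_rescaled_average_increment hn hl hu (hv_nonneg n) (sq_nonneg (g (n + 1)))
    have hstep := div_add_le_two_div_mul_sub hγ0 (sq_nonneg (g (n + 1))) (Real.sqrt_nonneg _)
      hE hgrow
    have hSmono : √((n : ℝ) * v n) ≤ √(((n + 1 : ℕ) : ℝ) * v (n + 1)) := by
      have := mul_nonneg hγ0.le (sq_nonneg (g (n + 1)))
      exact abs_le_of_sq_le_sq' (by linarith) (Real.sqrt_nonneg _) |>.2
    have hC : 2 / γ ≤ 2 * (2 - γ) / γ := by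
      gcongr
      linarith
    have hC0 : 0 ≤ 2 * (2 - γ) / γ := le_trans (by positivity) hC
    have h1 := mul_le_mul_of_nonneg_right hC (sub_nonneg.2 hSmono)
    have h2 := mul_nonneg hC0 (sub_nonneg.2 hEmono)
    linarith
end

section
/- Let T ≥ 2, 0 < γ ≤ 1, and let β_T satisfy 1 − 1/T ≤ β_T ≤ 1 − γ/T. Let v_{T−1} ≥ 0, g_T ∈ ℝ, and v_T = β_T v_{T−1} + (1 − β_T) g_T² with v_T > 0. Let ε_{T−1} > 0 and ε_T > 0 satisfy √(T−1) ε_{T−1} ≤ √T ε_T. Then √((T−1) v_{T−1}) + √(T−1) ε_{T−1} ≤ √(T v_T) + √T ε_T − (T−1)(1 − β_T) g_T² / (2 β_T (√(T v_T) + √T ε_T)). -/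
/-- The key inductive inequality (Equation (4) in the paper) in the proof of the RMSProp
summation lemma. -/
theorem rmsprop_inductive_step
    (T : ℕ) (hT : 2 ≤ T) (γ : ℝ) (hγ0 : 0 < γ) (hγ1 : γ ≤ 1)
    (βT : ℝ) (hβ1 : 1 - 1 / (T : ℝ) ≤ βT) (hβ2 : βT ≤ 1 - γ / (T : ℝ))
    (vTm1 : ℝ) (hvTm1 : 0 ≤ vTm1) (gT : ℝ)
    (vT : ℝ) (hvT : vT = βT * vTm1 + (1 - βT) * gT ^ 2) (hvTpos : 0 < vT)
    (εTm1 εT : ℝ) (hεTm1 : 0 < εTm1) (hεT : 0 < εT)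
    (hεmono : Real.sqrt ((T : ℝ) - 1) * εTm1 ≤ Real.sqrt (T : ℝ) * εT) :
    Real.sqrt (((T : ℝ) - 1) * vTm1) + Real.sqrt ((T : ℝ) - 1) * εTm1
      ≤ Real.sqrt ((T : ℝ) * vT) + Real.sqrt (T : ℝ) * εT
        - ((T : ℝ) - 1) * (1 - βT) * gT ^ 2
            / (2 * βT * (Real.sqrt ((T : ℝ) * vT) + Real.sqrt (T : ℝ) * εT)) := by
  have hT2 : (2 : ℝ) ≤ T := by exact_mod_cast hT
  have hTpos : (0 : ℝ) < T := by linarith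
  have hβT : (T : ℝ) - 1 ≤ βT * T := by
    have h := mul_le_mul_of_nonneg_right hβ1 hTpos.le
    rwa [sub_mul, one_mul, one_div, inv_mul_cancel₀ hTpos.ne'] at h
  have hβpos : 0 < βT := by
    by_contra! h
    nlinarith
  have hβle : βT ≤ 1 := by
    have : 0 < γ / (T : ℝ) := div_pos hγ0 hTpos
    linarith
  have hB : 0 < Real.sqrt ((T : ℝ) * vT) := Real.sqrt_pos.2 (mul_pos hTpos hvTpos)
  have hE : 0 < Real.sqrt (T : ℝ) * εT := mul_pos (Real.sqrt_pos.2 hTpos) hεT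
  have hA : 0 ≤ Real.sqrt (((T : ℝ) - 1) * vTm1) := Real.sqrt_nonneg _
  have hA2 : Real.sqrt (((T : ℝ) - 1) * vTm1) ^ 2 = ((T : ℝ) - 1) * vTm1 :=
    Real.sq_sqrt (mul_nonneg (by linarith) hvTm1)
  have hB2 : Real.sqrt ((T : ℝ) * vT) ^ 2 = (T : ℝ) * vT :=
    Real.sq_sqrt (mul_pos hTpos hvTpos).le
  set A := Real.sqrt (((T : ℝ) - 1) * vTm1)
  set B := Real.sqrt ((T : ℝ) * vT)
  set E := Real.sqrt (T : ℝ) * εT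
  have hN : ((T : ℝ) - 1) * (1 - βT) * gT ^ 2 ≤ βT * (B ^ 2 - A ^ 2) := by
    rw [hA2, hB2]
    have h := mul_le_mul_of_nonneg_right hβT hvTpos.le
    linear_combination h - ((T : ℝ) - 1) * hvT
  have hN0 : 0 ≤ ((T : ℝ) - 1) * (1 - βT) * gT ^ 2 :=
    mul_nonneg (mul_nonneg (by linarith) (by linarith)) (sq_nonneg _)
  have hAB : A ≤ B := by
    have h : 0 ≤ B ^ 2 - A ^ 2 := nonneg_of_mul_nonneg_right (hN0.trans hN) hβpos
    exact (sq_le_sq₀ hA hB.le).1 (by linarith)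
  have key : ((T : ℝ) - 1) * (1 - βT) * gT ^ 2 / (2 * βT * (B + E)) ≤ B - A := by
    rw [div_le_iff₀ (by positivity)]
    refine hN.trans ?_
    have h : 0 ≤ βT * ((B - A) * (B - A + 2 * E)) :=
      mul_nonneg hβpos.le (mul_nonneg (by linarith) (by linarith))
    linear_combination h
  linarith
end

section
/- Let d ≥ 1, T ≥ 1, 0 < γ ≤ 1, α > 0. Let g_1, …, g_T ∈ ℝ^d and let (β_t) satisfy 1 − 1/t ≤ β_t ≤ 1 − γ/t for all t ≥ 1. Define v_{0,i} = 0 and v_{t,i} = β_t v_{t−1,i} + (1 − β_t) g_{t,i}² for each coordinate i. Let ε_t > 0 satisfy √(t−1) ε_{t−1} ≤ √t ε_t for all t ≥ 2, and set α_t = α/√t. Then ∑_{t=1}^T (α_t/2) ∑_{i=1}^d g_{t,i}² / (√(v_{t,i}) + ε_t) ≤ (α(2 − γ)/γ) ∑_{i=1}^d (√(T v_{T,i}) + √T ε_T). -/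
/-- One step of the averaging recursion: the weighted term is paid for by the increase of
`√(t v_t)`. -/
lemma rmsprop_step_bound {n : ℕ} {γ β x y e : ℝ} (hγ : 0 < γ)
    (hβ : 1 - 1 / ((n + 1 : ℕ) : ℝ) ≤ β) (hβ' : β ≤ 1 - γ / ((n + 1 : ℕ) : ℝ))
    (hx : 0 ≤ x) (he : 0 < e) :
    0 ≤ β * x + (1 - β) * y ^ 2 ∧
      1 / √((n + 1 : ℕ) : ℝ) / 2 * (y ^ 2 / (√(β * x + (1 - β) * y ^ 2) + e)) ≤
        (√(((n + 1 : ℕ) : ℝ) * (β * x + (1 - β) * y ^ 2)) - √((n : ℝ) * x)) / γ := by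
  have hn : (0 : ℝ) ≤ n := n.cast_nonneg
  have ht : (0 : ℝ) < ((n + 1 : ℕ) : ℝ) := by positivity
  have htn : ((n + 1 : ℕ) : ℝ) = n + 1 := by push_cast; rfl
  set t : ℝ := ((n + 1 : ℕ) : ℝ)
  have hlow : (n : ℝ) ≤ t * β := by
    have h := mul_le_mul_of_nonneg_left hβ ht.le
    rw [mul_sub, mul_one_div_cancel ht.ne'] at h
    linarith
  have hupp : γ ≤ t * (1 - β) := by
    have h := mul_le_mul_of_nonneg_left hβ' ht.le
    rw [mul_sub, mul_div_cancel₀ _ ht.ne'] at h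
    linarith
  have hβ0 : 0 ≤ β := nonneg_of_mul_nonneg_right (hn.trans hlow) ht
  have hβ1 : 0 ≤ 1 - β := nonneg_of_mul_nonneg_right (hγ.le.trans hupp) ht
  set w : ℝ := β * x + (1 - β) * y ^ 2 with hw
  have hw0 : 0 ≤ w := by positivity
  refine ⟨hw0, ?_⟩
  have hkey : γ * y ^ 2 ≤ t * w - n * x := by
    have h1 := mul_le_mul_of_nonneg_right hlow hx
    have h2 := mul_le_mul_of_nonneg_right hupp (sq_nonneg y)
    rw [hw]
    linarith
  have hmono : √(n * x) ≤ √(t * w) :=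
    Real.sqrt_le_sqrt (by linarith [mul_nonneg hγ.le (sq_nonneg y)])
  have hs : √(t * w) ^ 2 = t * w := Real.sq_sqrt (by positivity)
  have hr : √(n * x) ^ 2 = n * x := Real.sq_sqrt (by positivity)
  have hst : 0 < √t := Real.sqrt_pos.2 ht
  have hden : 0 < 2 * (√(t * w) + √t * e) := by positivity
  have hterm : 1 / √t / 2 * (y ^ 2 / (√w + e)) = y ^ 2 / (2 * (√(t * w) + √t * e)) := by
    rw [Real.sqrt_mul ht.le, div_div, div_mul_div_comm, one_mul]
    congr 1
    ring
  rw [hterm, div_le_div_iff₀ hden hγ]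
  have h3 : 0 ≤ (√(t * w) - √(n * x)) * (√(t * w) - √(n * x) + 2 * (√t * e)) :=
    mul_nonneg (sub_nonneg.2 hmono) (add_nonneg (sub_nonneg.2 hmono) (by positivity))
  linarith

/-- The weighted sum along one coordinate is at most `√(n v_n) / γ`. -/
lemma rmsprop_coordinate_bound {γ : ℝ} (hγ : 0 < γ) {β y v ε : ℕ → ℝ}
    (hβ : ∀ t : ℕ, 1 ≤ t → 1 - 1 / (t : ℝ) ≤ β t ∧ β t ≤ 1 - γ / (t : ℝ))
    (hv0 : v 0 = 0) (hv : ∀ t : ℕ, 1 ≤ t → v t = β t * v (t - 1) + (1 - β t) * y t ^ 2)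
    (hε : ∀ t : ℕ, 1 ≤ t → 0 < ε t) (n : ℕ) :
    0 ≤ v n ∧ ∑ t ∈ Finset.Icc 1 n, 1 / √(t : ℝ) / 2 * (y t ^ 2 / (√(v t) + ε t)) ≤
      √((n : ℝ) * v n) / γ := by
  induction n with
  | zero => simp [hv0]
  | succ n ih =>
    have hn : 1 ≤ n + 1 := n.succ_pos
    have hstep := rmsprop_step_bound (y := y (n + 1)) hγ (hβ _ hn).1 (hβ _ hn).2 ih.1 (hε _ hn)
    have hvn := hv (n + 1) hn
    rw [Nat.add_sub_cancel] at hvn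
    rw [← hvn, sub_div] at hstep
    refine ⟨hstep.1, ?_⟩
    rw [Finset.sum_Icc_succ_top hn]
    linarith [ih.2, hstep.2]

/-- Corollary 8 in the paper: with step sizes `α_t = α/√t`,
`∑_{t=1}^T (α_t/2) ⟨g_t, A_t⁻¹ g_t⟩ ≤ (α(2−γ)/γ) ∑_i (√(T v_{T,i}) + √T ε_T)`
for the RMSProp matrices `A_t = diag(√v_t) + ε_t I`. -/
theorem rmsprop_weighted_sum_bound
    (d T : ℕ) (hd : 1 ≤ d) (hT : 1 ≤ T)
    (γ α : ℝ) (hγ0 : 0 < γ) (hγ1 : γ ≤ 1) (hα : 0 < α)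
    (g : ℕ → Fin d → ℝ) (β : ℕ → ℝ)
    (hβ : ∀ t : ℕ, 1 ≤ t → 1 - 1 / (t : ℝ) ≤ β t ∧ β t ≤ 1 - γ / (t : ℝ))
    (v : ℕ → Fin d → ℝ) (hv0 : ∀ i, v 0 i = 0)
    (hv : ∀ t : ℕ, 1 ≤ t → ∀ i, v t i = β t * v (t - 1) i + (1 - β t) * g t i ^ 2)
    (ε : ℕ → ℝ) (hε : ∀ t : ℕ, 1 ≤ t → 0 < ε t)
    (hεmono : ∀ t : ℕ, 2 ≤ t → Real.sqrt ((t : ℝ) - 1) * ε (t - 1) ≤ Real.sqrt (t : ℝ) * ε t) :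
    ∑ t ∈ Finset.Icc 1 T, (α / Real.sqrt (t : ℝ) / 2)
        * ∑ i, g t i ^ 2 / (Real.sqrt (v t i) + ε t)
      ≤ (α * (2 - γ) / γ)
        * ∑ i, (Real.sqrt ((T : ℝ) * v T i) + Real.sqrt (T : ℝ) * ε T) := by
  have hrw : ∑ t ∈ Finset.Icc 1 T, (α / √(t : ℝ) / 2) * ∑ i, g t i ^ 2 / (√(v t i) + ε t) =
      α * ∑ i, ∑ t ∈ Finset.Icc 1 T, 1 / √(t : ℝ) / 2 * (g t i ^ 2 / (√(v t i) + ε t)) := by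
    rw [Finset.sum_comm, Finset.mul_sum]
    refine Finset.sum_congr rfl fun t _ => ?_
    rw [← Finset.mul_sum]
    ring
  rw [hrw, mul_div_assoc, mul_assoc, Finset.mul_sum (a := (2 - γ) / γ)]
  refine mul_le_mul_of_nonneg_left (Finset.sum_le_sum fun i _ => ?_) hα.le
  have hεT := hε T hT
  calc
    _ ≤ √((T : ℝ) * v T i) / γ :=
      (rmsprop_coordinate_bound (v := fun t => v t i) (y := fun t => g t i) hγ0 hβ (hv0 i)
        (fun t ht => hv t ht i) hε T).2
    _ = 1 / γ * √((T : ℝ) * v T i) := by ring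
    _ ≤ (2 - γ) / γ * (√((T : ℝ) * v T i) + √(T : ℝ) * ε T) := by
      gcongr
      · exact div_nonneg (by linarith) hγ0.le
      · linarith
      · exact le_add_of_nonneg_right (by positivity)
end

section
/- Let d ≥ 1, T ≥ 1, 0 < γ ≤ 1, α > 0, D_∞ > 0, and C ⊆ ℝ^d convex. Let f_1, …, f_T : ℝ^d → ℝ, θ* ∈ C, θ_1, …, θ_{T+1} ∈ C and g_1, …, g_T ∈ ℝ^d satisfy: (i) for all t and all y ∈ C, f_t(y) ≥ f_t(θ_t) + ⟨g_t, y − θ_t⟩; (ii) |θ_{t,i} − θ*_i| ≤ D_∞ for all t, i. Let (β_t) satisfy 1 − 1/t ≤ β_t ≤ 1 − γ/t, define v_{0,i} = 0 and v_{t,i} = β_t v_{t−1,i} + (1 − β_t) g_{t,i}², let ε_t > 0 satisfy √(t−1) ε_{t−1} ≤ √t ε_t for t ≥ 2, set α_t = α/√t and a_{t,i} = √(v_{t,i}) + ε_t, and assume that for each t ∈ {1, …, T}, θ_{t+1} is the weighted projection with respect to a_t onto C of the point with coordinates θ_{t,i} − α_t g_{t,i}/a_{t,i}. Then ∑_{t=1}^T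 (f_t(θ_t) − f_t(θ*)) ≤ (D_∞²/(2α) + α(2 − γ)/γ) ∑_{i=1}^d (√(T v_{T,i}) + √T ε_T). -/
/-- One coordinate of the descent inequality for a preconditioned projected gradient step: the last
summand is the contribution of the coordinate to the variational inequality of the projection. -/
theorem projected_step_coord_le {r a α : ℝ} (hr : 0 < r) (ha : 0 < a) (x p s g : ℝ) :
    2 * α * (g * (x - s)) ≤ r * a * ((x - s) ^ 2 - (p - s) ^ 2) + α ^ 2 * (g ^ 2 / (r * a))
      + 2 * r * (a * ((x - α / r * g / a) - p) * (s - p)) := by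
  have key : r * a * ((x - s) ^ 2 - (p - s) ^ 2) + α ^ 2 * (g ^ 2 / (r * a))
      + 2 * r * (a * ((x - α / r * g / a) - p) * (s - p)) - 2 * α * (g * (x - s))
      = r * a * (x - α / r * g / a - p) ^ 2 := by
    field_simp
    ring
  have : 0 ≤ r * a * (x - α / r * g / a - p) ^ 2 := by positivity
  linarith

theorem sq_div_le_sqrt_sub_sqrt {γ U V g s : ℝ} (hγ : 0 < γ) (hU : 0 ≤ U)
    (h : U + γ * g ^ 2 ≤ V) (hs : 0 < s) (hVs : √V ≤ s) :
    g ^ 2 / s ≤ 2 / γ * (√V - √U) := by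
  have hUV : U ≤ V := by nlinarith [mul_nonneg hγ.le (sq_nonneg g)]
  have hle := Real.sqrt_le_sqrt hUV
  have hU2 := Real.sq_sqrt hU
  have hV2 := Real.sq_sqrt (hU.trans hUV)
  have hprod : (√V - √U) * (√V + √U) ≤ (√V - √U) * (2 * s) :=
    mul_le_mul_of_nonneg_left (by linarith) (by linarith)
  rw [div_mul_eq_mul_div, div_le_div_iff₀ hs hγ]
  nlinarith

/-- Summation by parts for a nondecreasing sequence of scaled preconditioners. -/
theorem sum_weighted_sq_sub_add_le {T : ℕ} {γ α D : ℝ} (hγ : 0 < γ) (x g s V : ℕ → ℝ)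
    (hx : ∀ t ∈ Finset.Icc 1 T, x t ^ 2 ≤ D ^ 2)
    (hV0 : V 0 = 0) (hV : ∀ n, V n + γ * g (n + 1) ^ 2 ≤ V (n + 1))
    (hs : ∀ n, 0 < s (n + 1)) (hVs : ∀ n, √(V (n + 1)) ≤ s (n + 1))
    (hmono : ∀ n, s (n + 1) ≤ s (n + 2)) (n : ℕ) (hn : n + 1 ≤ T) :
    ∑ t ∈ Finset.Icc 1 (n + 1), (s t * (x t ^ 2 - x (t + 1) ^ 2) + α ^ 2 * (g t ^ 2 / s t))
      ≤ s (n + 1) * (D ^ 2 - x (n + 2) ^ 2) + α ^ 2 * (2 / γ * √(V (n + 1))) := by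
  have hVnn : ∀ n, 0 ≤ V n := by
    intro n
    induction n with
    | zero => exact hV0.ge
    | succ n ih => exact (add_nonneg ih (by positivity)).trans (hV n)
  have hstep : ∀ n, α ^ 2 * (g (n + 1) ^ 2 / s (n + 1))
      ≤ α ^ 2 * (2 / γ * (√(V (n + 1)) - √(V n))) := fun n =>
    mul_le_mul_of_nonneg_left
      (sq_div_le_sqrt_sub_sqrt hγ (hVnn n) (hV n) (hs n) (hVs n)) (sq_nonneg α)
  induction n with
  | zero =>
    have h1 := hstep 0
    have h2 := mul_le_mul_of_nonneg_left (hx 1 (by simp; omega)) (hs 0).le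
    simp only [hV0, Real.sqrt_zero, zero_add, sub_zero] at h1 h2
    simp only [zero_add, Finset.Icc_self, Finset.sum_singleton, Nat.reduceAdd]
    linarith
  | succ n ih =>
    rw [Finset.sum_Icc_succ_top (by omega)]
    have h0 := ih (by omega)
    have h1 := hstep (n + 1)
    have h2 := hx (n + 2) (by simp; omega)
    have h3 := mul_le_mul_of_nonneg_right (hmono n) (sub_nonneg.2 h2)
    simp only [add_assoc, Nat.reduceAdd] at *
    linarith


/-- Regret bound for RMSProp in the online convex optimization setting
(Theorem 9 in the paper):
`R(T) ≤ (D_∞²/(2α) + α(2−γ)/γ) ∑_i (√(T v_{T,i}) + √T ε_T)`. -/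
theorem rmsprop_regret
    (d T : ℕ) (hd : 1 ≤ d) (hT : 1 ≤ T)
    (γ α Dinf : ℝ) (hγ0 : 0 < γ) (hγ1 : γ ≤ 1) (hα : 0 < α) (hDinf : 0 < Dinf)
    (C : Set (Fin d → ℝ)) (hC : Convex ℝ C)
    (f : ℕ → (Fin d → ℝ) → ℝ)
    (θs : Fin d → ℝ) (hθs : θs ∈ C)
    (θ : ℕ → Fin d → ℝ) (hθC : ∀ t ∈ Finset.Icc 1 (T + 1), θ t ∈ C)
    (g : ℕ → Fin d → ℝ)
    (hconv : ∀ t ∈ Finset.Icc 1 T, ∀ y ∈ C,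
      f t (θ t) + (∑ i, g t i * (y i - θ t i)) ≤ f t y)
    (hθb : ∀ t ∈ Finset.Icc 1 T, ∀ i, |θ t i - θs i| ≤ Dinf)
    (β : ℕ → ℝ)
    (hβ : ∀ t : ℕ, 1 ≤ t → 1 - 1 / (t : ℝ) ≤ β t ∧ β t ≤ 1 - γ / (t : ℝ))
    (v : ℕ → Fin d → ℝ) (hv0 : ∀ i, v 0 i = 0)
    (hv : ∀ t : ℕ, 1 ≤ t → ∀ i, v t i = β t * v (t - 1) i + (1 - β t) * g t i ^ 2)
    (ε : ℕ → ℝ) (hε : ∀ t : ℕ, 1 ≤ t → 0 < ε t)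
    (hεmono : ∀ t : ℕ, 2 ≤ t → Real.sqrt ((t : ℝ) - 1) * ε (t - 1) ≤ Real.sqrt (t : ℝ) * ε t)
    (a : ℕ → Fin d → ℝ) (ha : ∀ t i, a t i = Real.sqrt (v t i) + ε t)
    (hproj : ∀ t ∈ Finset.Icc 1 T, ∀ x ∈ C,
      ∑ i, a t i * ((θ t i - (α / Real.sqrt (t : ℝ)) * g t i / a t i) - θ (t + 1) i)
          * (x i - θ (t + 1) i) ≤ 0) :
    ∑ t ∈ Finset.Icc 1 T, (f t (θ t) - f t θs)
      ≤ (Dinf ^ 2 / (2 * α) + α * (2 - γ) / γ)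
        * ∑ i, (Real.sqrt ((T : ℝ) * v T i) + Real.sqrt (T : ℝ) * ε T) := by
  have hvnn : ∀ (n : ℕ) i, 0 ≤ (n : ℝ) * v n i ∧
      (n : ℝ) * v n i + γ * g (n + 1) i ^ 2 ≤ ((n + 1 : ℕ) : ℝ) * v (n + 1) i := by
    have hstep : ∀ (n : ℕ) i, 0 ≤ v n i →
        (n : ℝ) * v n i + γ * g (n + 1) i ^ 2 ≤ ((n + 1 : ℕ) : ℝ) * v (n + 1) i := by
      intro n i h
      obtain ⟨hb1, hb2⟩ := hβ (n + 1) (by omega)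
      have hn : (0 : ℝ) < ((n + 1 : ℕ) : ℝ) := by positivity
      have e1 : (n : ℝ) ≤ ((n + 1 : ℕ) : ℝ) * β (n + 1) := by
        have := mul_le_mul_of_nonneg_left hb1 hn.le
        rw [mul_sub, mul_one_div_cancel hn.ne'] at this
        push_cast at this ⊢
        linarith
      have e2 : γ ≤ ((n + 1 : ℕ) : ℝ) * (1 - β (n + 1)) := by
        have := mul_le_mul_of_nonneg_left hb2 hn.le
        rw [mul_sub, mul_div_cancel₀ _ hn.ne'] at this
        linarith
      rw [hv (n + 1) (by omega) i, Nat.add_sub_cancel]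
      have := mul_le_mul_of_nonneg_right e1 h
      have := mul_le_mul_of_nonneg_right e2 (sq_nonneg (g (n + 1) i))
      linarith
    have hnn : ∀ n i, 0 ≤ v n i := by
      intro n i
      induction n with
      | zero => exact (hv0 i).ge
      | succ n ih =>
        refine (mul_nonneg_iff_of_pos_left (by positivity : (0 : ℝ) < ((n + 1 : ℕ) : ℝ))).1 ?_
        exact le_trans (by positivity) (hstep n i ih)
    exact fun n i => ⟨mul_nonneg n.cast_nonneg (hnn n i), hstep n i (hnn n i)⟩
  have hsa : ∀ (t : ℕ) i, √(t : ℝ) * a t i = √((t : ℝ) * v t i) + √(t : ℝ) * ε t := by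
    intro t i
    rw [ha, mul_add, Real.sqrt_mul t.cast_nonneg]
  have hr : ∀ t : ℕ, 1 ≤ t → 0 < √(t : ℝ) := fun t ht =>
    Real.sqrt_pos.2 (by exact_mod_cast ht)
  have hapos : ∀ t : ℕ, 1 ≤ t → ∀ i, 0 < a t i := fun t ht i => by
    rw [ha]
    exact add_pos_of_nonneg_of_pos (Real.sqrt_nonneg _) (hε t ht)
  have hregret : ∀ t ∈ Finset.Icc 1 T, 2 * α * (f t (θ t) - f t θs) ≤
      ∑ i, (√(t : ℝ) * a t i * ((θ t i - θs i) ^ 2 - (θ (t + 1) i - θs i) ^ 2)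
        + α ^ 2 * (g t i ^ 2 / (√(t : ℝ) * a t i))) := by
    intro t ht
    have ht1 := (Finset.mem_Icc.1 ht).1
    have h1 := Finset.sum_le_sum fun i (_ : i ∈ Finset.univ) =>
      projected_step_coord_le (α := α) (hr t ht1) (hapos t ht1 i)
        (θ t i) (θ (t + 1) i) (θs i) (g t i)
    rw [Finset.sum_add_distrib, ← Finset.mul_sum, ← Finset.mul_sum] at h1
    have h2 := mul_nonpos_of_nonneg_of_nonpos
      (by positivity : 0 ≤ 2 * √(t : ℝ)) (hproj t ht θs hθs)
    have h3 : ∑ i, g t i * (θs i - θ t i) = -∑ i, g t i * (θ t i - θs i) := by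
      rw [← Finset.sum_neg_distrib]
      exact Finset.sum_congr rfl fun i _ => by ring
    have h4 := hconv t ht θs hθs
    have h5 : 2 * α * (f t (θ t) - f t θs) ≤ 2 * α * ∑ i, g t i * (θ t i - θs i) :=
      mul_le_mul_of_nonneg_left (by linarith) (by positivity)
    linarith
  have hcoord : ∀ i, ∑ t ∈ Finset.Icc 1 T,
      (√(t : ℝ) * a t i * ((θ t i - θs i) ^ 2 - (θ (t + 1) i - θs i) ^ 2)
        + α ^ 2 * (g t i ^ 2 / (√(t : ℝ) * a t i)))
      ≤ (Dinf ^ 2 + α ^ 2 * (2 * (2 - γ) / γ)) * (√(T : ℝ) * a T i) := by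
    intro i
    obtain ⟨n, rfl⟩ : ∃ n, T = n + 1 := ⟨T - 1, by omega⟩
    have hspos : ∀ m : ℕ, 0 < √((m + 1 : ℕ) : ℝ) * a (m + 1) i := fun m =>
      mul_pos (hr _ (by omega)) (hapos _ (by omega) i)
    have hVs : ∀ m : ℕ, √(((m + 1 : ℕ) : ℝ) * v (m + 1) i) ≤ √((m + 1 : ℕ) : ℝ) * a (m + 1) i := by
      intro m
      rw [hsa]
      exact le_add_of_nonneg_right (mul_nonneg (Real.sqrt_nonneg _) (hε _ (by omega)).le)
    have hsum := sum_weighted_sq_sub_add_le (T := n + 1) (α := α) (D := Dinf) hγ0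
      (fun t => θ t i - θs i) (fun t => g t i) (fun t => √(t : ℝ) * a t i)
      (fun t => (t : ℝ) * v t i)
      (fun t ht => sq_le_sq' (abs_le.1 (hθb t ht i)).1 (abs_le.1 (hθb t ht i)).2)
      (by simp) (fun m => (hvnn m i).2) hspos hVs ?_ n le_rfl
    · refine hsum.trans ?_
      have h1 : 0 ≤ √((n + 1 : ℕ) : ℝ) * a (n + 1) i * (θ (n + 2) i - θs i) ^ 2 :=
        mul_nonneg (hspos n).le (sq_nonneg _)
      have h2 : 2 / γ * √(((n + 1 : ℕ) : ℝ) * v (n + 1) i)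
          ≤ 2 * (2 - γ) / γ * (√((n + 1 : ℕ) : ℝ) * a (n + 1) i) := by
        refine mul_le_mul ?_ (hVs n) (Real.sqrt_nonneg _) ?_
        · gcongr
          linarith
        · exact div_nonneg (by linarith) hγ0.le
      have h3 := mul_le_mul_of_nonneg_left h2 (sq_nonneg α)
      linarith
    · intro m
      have h1 := hεmono (m + 2) (by omega)
      have h2 : ((m + 2 : ℕ) : ℝ) - 1 = ((m + 1 : ℕ) : ℝ) := by push_cast; ring
      rw [h2, show m + 2 - 1 = m + 1 from rfl] at h1
      simp only [hsa]
      refine add_le_add (Real.sqrt_le_sqrt ?_) h1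
      exact le_trans (le_add_of_nonneg_right (by positivity)) (hvnn (m + 1) i).2
  have htotal : 2 * α * ∑ t ∈ Finset.Icc 1 T, (f t (θ t) - f t θs)
      ≤ (Dinf ^ 2 + α ^ 2 * (2 * (2 - γ) / γ)) * ∑ i, √(T : ℝ) * a T i := by
    rw [Finset.mul_sum, Finset.mul_sum]
    refine (Finset.sum_le_sum hregret).trans ?_
    rw [Finset.sum_comm]
    exact Finset.sum_le_sum fun i _ => hcoord i
  simp only [← hsa]
  refine le_of_mul_le_mul_left (htotal.trans_eq ?_) (by positivity : 0 < 2 * α)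
  rw [← mul_assoc]
  congr 1
  field_simp
end

section
/- Let t ≥ 2, let v_{t−1} ≥ 0, g ∈ ℝ, and let β_t satisfy 1 − 1/t ≤ β_t ≤ 1. Define v_t = β_t v_{t−1} + (1 − β_t) g². Let ε_{t−1} ≥ 0 and ε_t ≥ 0 satisfy √(t−1) ε_{t−1} ≤ √t ε_t. Then √((t−1) v_{t−1}) + √(t−1) ε_{t−1} ≤ √(t v_t) + √t ε_t. -/
/-- Per-entry monotonicity `√t A_t ⪰ √(t−1) A_{t−1}` of the RMSProp matrices
`A_t = diag(√v_t) + ε_t I`. -/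
theorem rmsprop_sqrt_monotone
    (t : ℕ) (ht : 2 ≤ t)
    (vtm1 : ℝ) (hvtm1 : 0 ≤ vtm1) (g : ℝ)
    (βt : ℝ) (hβ1 : 1 - 1 / (t : ℝ) ≤ βt) (hβ2 : βt ≤ 1)
    (vt : ℝ) (hvt : vt = βt * vtm1 + (1 - βt) * g ^ 2)
    (εtm1 εt : ℝ) (hεtm1 : 0 ≤ εtm1) (hεt : 0 ≤ εt)
    (hεmono : Real.sqrt ((t : ℝ) - 1) * εtm1 ≤ Real.sqrt (t : ℝ) * εt) :
    Real.sqrt (((t : ℝ) - 1) * vtm1) + Real.sqrt ((t : ℝ) - 1) * εtm1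
      ≤ Real.sqrt ((t : ℝ) * vt) + Real.sqrt (t : ℝ) * εt := by
  have ht0 : (0 : ℝ) < t := by exact_mod_cast (by omega : 0 < t)
  have hβ : (t : ℝ) - 1 ≤ t * βt := by
    calc (t : ℝ) - 1 = t * (1 - 1 / (t : ℝ)) := by field_simp
      _ ≤ t * βt := by gcongr
  have hg : 0 ≤ (t : ℝ) * ((1 - βt) * g ^ 2) :=
    mul_nonneg ht0.le (mul_nonneg (sub_nonneg.mpr hβ2) (sq_nonneg g))
  have hv : ((t : ℝ) - 1) * vtm1 ≤ t * vt := by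
    calc ((t : ℝ) - 1) * vtm1 ≤ t * βt * vtm1 := by gcongr
      _ ≤ t * βt * vtm1 + t * ((1 - βt) * g ^ 2) := le_add_of_nonneg_right hg
      _ = t * vt := by rw [hvt]; ring
  exact add_le_add (Real.sqrt_le_sqrt hv) hεmono
end

section
/- Let d ≥ 1, T ≥ 1, 0 < γ ≤ 1, α > 0. Let g_1, …, g_T ∈ ℝ^d and let (β_t) satisfy 1 − 1/t ≤ β_t ≤ 1 − γ/t for all t ≥ 1. Define v_{0,i} = 0 and v_{t,i} = β_t v_{t−1,i} + (1 − β_t) g_{t,i}² for each coordinate i. Let ε_t ∈ ℝ^d satisfy 0 < ε_{t,i} ≤ 1/t for all t, i, and t ε_{t,i} ≤ (t−1) ε_{t−1,i} for all t ≥ 2 and all i. Then ∑_{t=2}^T (α/2) ∑_{i=1}^d (−ε_{t,i} + β_t ε_{t−1,i}) / ((1 − β_t) · t · (v_{t,i} + ε_{t,i})) ≤ (α/(2γ)) ∑_{t=2}^T ∑_{i=1}^d (−t ε_{t,i} + (t−1) ε_{t−1,i}) / (t v_{t,i} + t ε_{t,i}) + (α/(2γ)) ∑_{i=1}^d (1 −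 γ)(1 + log T) / min_{j ∈ {1,…,T}} (j v_{j,i} + j ε_{j,i}). -/
/-- An exponential running average of squares with weights in `[0, 1]` is nonnegative. -/
theorem runningAverage_sq_nonneg {β g v : ℕ → ℝ} (hβ0 : ∀ t, 1 ≤ t → 0 ≤ β t)
    (hβ1 : ∀ t, 1 ≤ t → β t ≤ 1) (hv0 : v 0 = 0)
    (hv : ∀ t, 1 ≤ t → v t = β t * v (t - 1) + (1 - β t) * g t ^ 2) (t : ℕ) : 0 ≤ v t := by
  induction t with
  | zero => exact hv0.ge
  | succ n ih =>
    rw [hv (n + 1) n.succ_pos]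
    exact add_nonneg (mul_nonneg (hβ0 _ n.succ_pos) ih)
      (mul_nonneg (sub_nonneg.mpr (hβ1 _ n.succ_pos)) (sq_nonneg _))

theorem sum_Icc_two_one_div_sub_one (n : ℕ) :
    ∑ t ∈ Finset.Icc 2 (n + 1), 1 / ((t : ℝ) - 1) = harmonic n := by
  induction n with
  | zero => simp
  | succ n ih =>
    rw [Finset.sum_Icc_succ_top (by lia), ih, harmonic_succ]
    push_cast
    ring

theorem sum_Icc_two_one_div_sub_one_le {T : ℕ} (hT : 1 ≤ T) :
    ∑ t ∈ Finset.Icc 2 T, 1 / ((t : ℝ) - 1) ≤ 1 + Real.log T := by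
  obtain ⟨n, rfl⟩ := Nat.exists_eq_add_of_le' hT
  rw [sum_Icc_two_one_div_sub_one]
  calc (harmonic n : ℝ) ≤ harmonic (n + 1) := by
        rw [harmonic_succ]
        push_cast
        linarith [show (0 : ℝ) ≤ ((n : ℝ) + 1)⁻¹ by positivity]
    _ ≤ 1 + Real.log ((n + 1 : ℕ) : ℝ) := harmonic_le_one_add_log _

/-- Bound on a single damping correction: here `b` is the decay rate at time `t`, and `e'`, `e` are
the damping parameters at times `t - 1` and `t`. -/
theorem damping_term_le {γ t b v e e' m : ℝ} (hγ0 : 0 < γ) (hγ1 : γ ≤ 1) (ht : 1 < t)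
    (hb : b ≤ 1 - γ / t) (hm : 0 < m) (hmv : m ≤ t * v + t * e)
    (he0 : 0 < e') (he1 : e' ≤ 1 / (t - 1)) (hmono : t * e ≤ (t - 1) * e') :
    (-e + b * e') / ((1 - b) * t * (v + e)) ≤
      1 / γ * ((-(t * e) + (t - 1) * e') / (t * v + t * e)
        + (1 - γ) * (1 / (t - 1)) / m) := by
  have ht0 : 0 < t := by linarith
  obtain ⟨s, rfl⟩ : ∃ s, b = 1 - s / t := ⟨(1 - b) * t, by field_simp; ring⟩
  have hsγ : γ ≤ s := (div_le_div_iff_of_pos_right ht0).mp (by linarith)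
  have hs0 : 0 < s := hγ0.trans_le hsγ
  have hD : 0 < t * v + t * e := hm.trans_le hmv
  have key : (-(t * e) + (t - s) * e') / s ≤
      (-(t * e) + (t - 1) * e' + (1 - γ) * e') / γ := by
    rw [div_le_div_iff₀ hs0 hγ0]
    nlinarith [mul_nonneg (sub_nonneg.mpr hsγ) (sub_nonneg.mpr hmono),
      mul_nonneg (sub_nonneg.mpr hsγ) he0.le]
  calc (-e + (1 - s / t) * e') / ((1 - (1 - s / t)) * t * (v + e))
      = (-(t * e) + (t - s) * e') / s / (t * v + t * e) := by
        rw [← mul_add, sub_sub_cancel, div_mul_cancel₀ _ ht0.ne']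
        field_simp
    _ ≤ (-(t * e) + (t - 1) * e' + (1 - γ) * e') / γ / (t * v + t * e) := by gcongr
    _ = 1 / γ * ((-(t * e) + (t - 1) * e') / (t * v + t * e)
        + (1 - γ) * e' / (t * v + t * e)) := by ring
    _ ≤ _ := by
        have : 0 ≤ 1 - γ := sub_nonneg.mpr hγ1
        have : 0 < t - 1 := sub_pos.mpr ht
        gcongr

/-- Lemma 11 in the paper: bound on the damping correction term in the SC-RMSProp analysis. -/
theorem sc_rmsprop_damping_lemma
    (d T : ℕ) (hd : 1 ≤ d) (hT : 1 ≤ T)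
    (γ α : ℝ) (hγ0 : 0 < γ) (hγ1 : γ ≤ 1) (hα : 0 < α)
    (g : ℕ → Fin d → ℝ) (β : ℕ → ℝ)
    (hβ : ∀ t : ℕ, 1 ≤ t → 1 - 1 / (t : ℝ) ≤ β t ∧ β t ≤ 1 - γ / (t : ℝ))
    (v : ℕ → Fin d → ℝ) (hv0 : ∀ i, v 0 i = 0)
    (hv : ∀ t : ℕ, 1 ≤ t → ∀ i, v t i = β t * v (t - 1) i + (1 - β t) * g t i ^ 2)
    (ε : ℕ → Fin d → ℝ)
    (hε : ∀ t : ℕ, 1 ≤ t → ∀ i, 0 < ε t i ∧ ε t i ≤ 1 / (t : ℝ))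
    (hεmono : ∀ t : ℕ, 2 ≤ t → ∀ i, (t : ℝ) * ε t i ≤ ((t : ℝ) - 1) * ε (t - 1) i) :
    ∑ t ∈ Finset.Icc 2 T, (α / 2)
        * ∑ i, (-(ε t i) + β t * ε (t - 1) i) / ((1 - β t) * (t : ℝ) * (v t i + ε t i))
      ≤ (α / (2 * γ)) * ∑ t ∈ Finset.Icc 2 T, ∑ i,
            (-((t : ℝ) * ε t i) + ((t : ℝ) - 1) * ε (t - 1) i)
              / ((t : ℝ) * v t i + (t : ℝ) * ε t i)
        + (α / (2 * γ)) * ∑ i,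
            (1 - γ) * (1 + Real.log (T : ℝ))
              / ((Finset.Icc 1 T).inf' (Finset.nonempty_Icc.mpr hT)
                  (fun j => (j : ℝ) * v j i + (j : ℝ) * ε j i)) := by
  have hpos (i : Fin d) : 0 < (Finset.Icc 1 T).inf' (Finset.nonempty_Icc.mpr hT)
      (fun j => (j : ℝ) * v j i + (j : ℝ) * ε j i) := by
    rw [Finset.lt_inf'_iff]
    intro j hj
    have hj1 := (Finset.mem_Icc.mp hj).1
    have hj0 : (0 : ℝ) < j := by exact_mod_cast hj1
    have hvj : 0 ≤ v j i := runningAverage_sq_nonneg (g := fun t => g t i) (v := fun t => v t i)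
      (fun t ht => le_trans
        (sub_nonneg.mpr (div_le_one_of_le₀ (by exact_mod_cast ht) t.cast_nonneg)) (hβ t ht).1)
      (fun t ht => (hβ t ht).2.trans (sub_le_self _ (by positivity)))
      (hv0 i) (fun t ht => hv t ht i) j
    exact add_pos_of_nonneg_of_pos (mul_nonneg hj0.le hvj) (mul_pos hj0 (hε j hj1 i).1)
  set m : Fin d → ℝ := fun i => (Finset.Icc 1 T).inf' (Finset.nonempty_Icc.mpr hT)
    (fun j => (j : ℝ) * v j i + (j : ℝ) * ε j i)
  have hterm : ∀ t ∈ Finset.Icc 2 T, ∀ i,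
      (-(ε t i) + β t * ε (t - 1) i) / ((1 - β t) * (t : ℝ) * (v t i + ε t i)) ≤
        1 / γ * ((-((t : ℝ) * ε t i) + ((t : ℝ) - 1) * ε (t - 1) i)
            / ((t : ℝ) * v t i + (t : ℝ) * ε t i)
          + (1 - γ) * (1 / ((t : ℝ) - 1)) / m i) := by
    intro t ht i
    obtain ⟨ht2, htT⟩ := Finset.mem_Icc.mp ht
    have ht1 : 1 ≤ t := by lia
    have hε' := hε (t - 1) (by lia) i
    rw [Nat.cast_sub ht1, Nat.cast_one] at hε'
    exact damping_term_le hγ0 hγ1 (by exact_mod_cast ht2) (hβ t ht1).2 (hpos i)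
      (Finset.inf'_le _ (Finset.mem_Icc.mpr ⟨ht1, htT⟩)) hε'.1 hε'.2 (hεmono t ht2 i)
  calc _ ≤ ∑ t ∈ Finset.Icc 2 T, (α / 2) * ∑ i,
        1 / γ * ((-((t : ℝ) * ε t i) + ((t : ℝ) - 1) * ε (t - 1) i)
            / ((t : ℝ) * v t i + (t : ℝ) * ε t i)
          + (1 - γ) * (1 / ((t : ℝ) - 1)) / m i) := by
        gcongr with t ht i
        exact hterm t ht i
    _ = (α / (2 * γ)) * ∑ t ∈ Finset.Icc 2 T, ∑ i,
            (-((t : ℝ) * ε t i) + ((t : ℝ) - 1) * ε (t - 1) i)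
              / ((t : ℝ) * v t i + (t : ℝ) * ε t i)
        + (α / (2 * γ)) * ∑ i,
            (1 - γ) * (∑ t ∈ Finset.Icc 2 T, 1 / ((t : ℝ) - 1)) / m i := by
        simp_rw [Finset.mul_sum (Finset.Icc 2 T) _ (1 - γ), Finset.sum_div]
        rw [Finset.sum_comm (s := Finset.univ), ← mul_add, ← Finset.sum_add_distrib,
          Finset.mul_sum]
        refine Finset.sum_congr rfl fun t _ => ?_
        rw [← Finset.sum_add_distrib, ← Finset.mul_sum]
        field_simp
    _ ≤ _ := by
        have : 0 ≤ 1 - γ := sub_nonneg.mpr hγ1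
        gcongr with i
        · exact (hpos i).le
        · exact sum_Icc_two_one_div_sub_one_le hT
end

section
/- Let d ≥ 1, T ≥ 1, 0 < γ ≤ 1, C ⊆ ℝ^d convex, μ ∈ ℝ^d with μ_i > 0 for all i, and G_∞, D_∞ > 0. Let f_1, …, f_T : ℝ^d → ℝ, θ* ∈ C, θ_1, …, θ_{T+1} ∈ C and g_1, …, g_T ∈ ℝ^d satisfy: (i) for all t and all y ∈ C, f_t(y) ≥ f_t(θ_t) + ⟨g_t, y − θ_t⟩ + ∑_{i=1}^d μ_i (y_i − θ_{t,i})²; (ii) |g_{t,i}| ≤ G_∞ and |θ_{t,i} − θ*_i| ≤ D_∞ for all t, i. Let (β_t) satisfy 1 − 1/t ≤ β_t ≤ 1 − γ/t, define v_{0,i} = 0 and v_{t,i} = β_t v_{t−1,i} + (1 − β_t) g_{t,i}². Let δ_t ∈ ℝ^d satisfy 0 < δ_{t,i} ≤ 1 for all t, i and δ_{t,i} ≤ δ_{t−1,i} for t ≥ 2, and set ε_{t,i} = δ_{t,i}/t, α_t = α/t, and a_{t,i} = v_{t,i} + ε_{t,i}. Assume α ≥ (2 − γ) G_∞² / (2 min_i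 μ_i) and that for each t ∈ {1, …, T}, θ_{t+1} is the weighted projection with respect to a_t onto C of the point with coordinates θ_{t,i} − α_t g_{t,i}/a_{t,i}. Then ∑_{t=1}^T (f_t(θ_t) − f_t(θ*)) ≤ D_∞² (∑_{i=1}^d δ_{1,i})/(2α) + (α/(2γ)) ∑_{i=1}^d log((T v_{T,i} + δ_{T,i})/δ_{1,i}) + (1/2) ∑_{i=1}^d [min_{t ∈ {1,…,T}} ((θ_{t,i} − θ*_i)²/α − α/(γ (t v_{t,i} + t ε_{t,i})))] · (δ_{T,i} − δ_{1,i}) + (α/(2γ)) ∑_{i=1}^d (1 − γ)(1 + log T) / min_{j ∈ {1,…,T}} (j v_{j,i} + j ε_{j,i}). -/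
/-- Second-moment averages of a bounded sequence stay between `0` and the squared bound. -/
theorem second_moment_mem_Icc {T : ℕ} {γ G : ℝ} (hγ0 : 0 < γ) {g β v : ℕ → ℝ}
    (hgb : ∀ t ∈ Finset.Icc 1 T, |g t| ≤ G)
    (hβ : ∀ t : ℕ, 1 ≤ t → 1 - 1 / (t : ℝ) ≤ β t ∧ β t ≤ 1 - γ / (t : ℝ))
    (hv0 : v 0 = 0)
    (hv : ∀ t : ℕ, 1 ≤ t → v t = β t * v (t - 1) + (1 - β t) * g t ^ 2)
    (n : ℕ) (hn : n ≤ T) : 0 ≤ v n ∧ v n ≤ G ^ 2 := by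
  induction n with
  | zero => rw [hv0]; exact ⟨le_rfl, sq_nonneg G⟩
  | succ n ih =>
    obtain ⟨h0, h1⟩ := ih (by omega)
    obtain ⟨hl, hu⟩ := hβ (n + 1) (by omega)
    have hβ0 : 0 ≤ β (n + 1) := by
      have : 1 / ((n + 1 : ℕ) : ℝ) ≤ 1 := by
        rw [div_le_one (by positivity)]; push_cast; linarith [n.cast_nonneg (α := ℝ)]
      linarith
    have hβ1 : 0 ≤ 1 - β (n + 1) := by
      have : 0 ≤ γ / ((n + 1 : ℕ) : ℝ) := by positivity
      linarith
    have hg : g (n + 1) ^ 2 ≤ G ^ 2 :=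
      sq_le_sq' (by linarith [abs_le.mp (hgb (n + 1) (by simp; omega))])
        (abs_le.mp (hgb (n + 1) (by simp; omega))).2
    rw [hv (n + 1) (by omega), Nat.add_sub_cancel]
    constructor
    · positivity
    · nlinarith [mul_le_mul_of_nonneg_left h1 hβ0, mul_le_mul_of_nonneg_left hg hβ1]

/-- The increments of `t * v t` dominate `γ * g t ^ 2` and are at most `(2 - γ) * G ^ 2`. -/
theorem second_moment_increment {T : ℕ} {γ G : ℝ} (hγ0 : 0 < γ) (hγ1 : γ ≤ 1) {g β v : ℕ → ℝ}
    (hgb : ∀ t ∈ Finset.Icc 1 T, |g t| ≤ G)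
    (hβ : ∀ t : ℕ, 1 ≤ t → 1 - 1 / (t : ℝ) ≤ β t ∧ β t ≤ 1 - γ / (t : ℝ))
    (hv0 : v 0 = 0)
    (hv : ∀ t : ℕ, 1 ≤ t → v t = β t * v (t - 1) + (1 - β t) * g t ^ 2)
    (n : ℕ) (hn : n + 1 ≤ T) :
    γ * g (n + 1) ^ 2 ≤ ((n + 1 : ℕ) : ℝ) * v (n + 1) - n * v n ∧
      ((n + 1 : ℕ) : ℝ) * v (n + 1) - n * v n ≤ (2 - γ) * G ^ 2 := by
  obtain ⟨h0, h1⟩ := second_moment_mem_Icc hγ0 hgb hβ hv0 hv n (by omega)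
  obtain ⟨hl, hu⟩ := hβ (n + 1) (by omega)
  have hpos : (0 : ℝ) < ((n + 1 : ℕ) : ℝ) := by positivity
  have hl' : (n : ℝ) ≤ ((n + 1 : ℕ) : ℝ) * β (n + 1) := by
    have := mul_le_mul_of_nonneg_left hl hpos.le
    rw [mul_sub, mul_one_div_cancel hpos.ne'] at this
    push_cast at this ⊢; linarith
  have hu' : ((n + 1 : ℕ) : ℝ) * β (n + 1) ≤ n + 1 - γ := by
    have := mul_le_mul_of_nonneg_left hu hpos.le
    rw [mul_sub, mul_div_cancel₀ _ hpos.ne'] at this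
    push_cast at this ⊢; linarith
  have hg : g (n + 1) ^ 2 ≤ G ^ 2 :=
    sq_le_sq' (by linarith [abs_le.mp (hgb (n + 1) (by simp; omega))])
      (abs_le.mp (hgb (n + 1) (by simp; omega))).2
  have hexp : ((n + 1 : ℕ) : ℝ) * v (n + 1) - n * v n
      = (((n + 1 : ℕ) : ℝ) * β (n + 1) - n) * v n
        + (n + 1 - ((n + 1 : ℕ) : ℝ) * β (n + 1)) * g (n + 1) ^ 2 := by
    rw [hv (n + 1) (by omega), Nat.add_sub_cancel]; push_cast; ring
  rw [hexp]
  generalize ((n + 1 : ℕ) : ℝ) * β (n + 1) = b at hl' hu'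
  constructor
  · nlinarith [mul_nonneg (sub_nonneg.2 hl') h0,
      mul_nonneg (sub_nonneg.2 hu') (sq_nonneg (g (n + 1)))]
  · nlinarith [mul_nonneg (sub_nonneg.2 hl') (sub_nonneg.2 h1),
      mul_nonneg (by linarith : (0 : ℝ) ≤ n + 1 - b) (sub_nonneg.2 hg),
      mul_nonneg (sub_nonneg.2 hu') (sq_nonneg G)]

/-- Logarithmic bound for one increment of a positive sequence. -/
theorem one_sub_div_le_log_sub_log {r s : ℝ} (hr : 0 < r) (hs : 0 < s) :
    1 - r / s ≤ Real.log s - Real.log r := by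
  have := Real.log_le_sub_one_of_pos (div_pos hr hs)
  rw [Real.log_div hr.ne' hs.ne'] at this
  linarith

/-- One step of the potential argument: `r` and `s` are consecutive values of `t * v t + δ t`,
and `e` is the corresponding increment of `δ`. -/
theorem potential_step {α γ μ G r s e x g m : ℝ} (hα : 0 < α) (hγ0 : 0 < γ)
    (hαμ : (2 - γ) * G ^ 2 ≤ 2 * μ * α) (hr : 0 < r) (hs : 0 < s) (he : e ≤ 0)
    (hlow : γ * g ^ 2 ≤ s - r - e) (hupp : s - r - e ≤ (2 - γ) * G ^ 2)
    (hm : m ≤ x ^ 2 / α - α / (γ * s)) :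
    s / (2 * α) * x ^ 2 - r / (2 * α) * x ^ 2 + α * g ^ 2 / (2 * s) - μ * x ^ 2
      ≤ α / (2 * γ) * (Real.log s - Real.log r) + 1 / 2 * (m * e) := by
  have h1 : s / (2 * α) * x ^ 2 - r / (2 * α) * x ^ 2 - μ * x ^ 2
      ≤ 1 / 2 * (x ^ 2 / α * e) := by
    have : (s - r - e - 2 * μ * α) * x ^ 2 / (2 * α) ≤ 0 := by
      apply div_nonpos_of_nonpos_of_nonneg _ (by positivity)
      exact mul_nonpos_of_nonpos_of_nonneg (by linarith) (sq_nonneg x)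
    have h : (s - r - e - 2 * μ * α) * x ^ 2 / (2 * α)
      = s / (2 * α) * x ^ 2 - r / (2 * α) * x ^ 2 - μ * x ^ 2 - 1 / 2 * (x ^ 2 / α * e) := by
      field_simp
      ring
    linarith
  have h2 : α * g ^ 2 / (2 * s)
      ≤ α / (2 * γ) * (Real.log s - Real.log r) - 1 / 2 * (α / (γ * s) * e) := by
    have hlog := mul_le_mul_of_nonneg_left (one_sub_div_le_log_sub_log hr hs)
      (by positivity : 0 ≤ α / (2 * γ))
    have h3 : α / (2 * γ * s) * (γ * g ^ 2) ≤ α / (2 * γ * s) * (s - r - e) :=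
      mul_le_mul_of_nonneg_left hlow (by positivity)
    have h4 : α / (2 * γ * s) * (γ * g ^ 2) = α * g ^ 2 / (2 * s) := by field_simp
    have h5 : α / (2 * γ * s) * (s - r - e)
      = α / (2 * γ) * (1 - r / s) - 1 / 2 * (α / (γ * s) * e) := by field_simp
    linarith
  have h3 := mul_le_mul_of_nonpos_right hm he
  rw [sub_mul] at h3
  linarith

/-- Summed potential bound in one coordinate, with `x t` the distance to the comparator. -/
theorem coordinate_regret_le {T : ℕ} {α γ μ G D m : ℝ} (hγ0 : 0 < γ) (hγ1 : γ ≤ 1)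
    (hα : 0 < α) (hαμ : (2 - γ) * G ^ 2 ≤ 2 * μ * α) {g β v δ x : ℕ → ℝ}
    (hgb : ∀ t ∈ Finset.Icc 1 T, |g t| ≤ G)
    (hxb : ∀ t ∈ Finset.Icc 1 T, |x t| ≤ D)
    (hβ : ∀ t : ℕ, 1 ≤ t → 1 - 1 / (t : ℝ) ≤ β t ∧ β t ≤ 1 - γ / (t : ℝ))
    (hv0 : v 0 = 0)
    (hv : ∀ t : ℕ, 1 ≤ t → v t = β t * v (t - 1) + (1 - β t) * g t ^ 2)
    (hδ : ∀ t : ℕ, 1 ≤ t → 0 < δ t)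
    (hδmono : ∀ t : ℕ, 2 ≤ t → δ t ≤ δ (t - 1))
    (hm : ∀ t ∈ Finset.Icc 1 T, m ≤ x t ^ 2 / α - α / (γ * (t * v t + δ t)))
    (n : ℕ) (hn1 : 1 ≤ n) (hnT : n ≤ T) :
    (∑ t ∈ Finset.Icc 1 n, ((t * v t + δ t) / (2 * α) * (x t ^ 2 - x (t + 1) ^ 2)
        + α * g t ^ 2 / (2 * (t * v t + δ t)) - μ * x t ^ 2))
      + (n * v n + δ n) / (2 * α) * x (n + 1) ^ 2
      ≤ D ^ 2 * δ 1 / (2 * α) + α / (2 * γ) * Real.log ((n * v n + δ n) / δ 1)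
        + 1 / 2 * (m * (δ n - δ 1)) := by
  have hs : ∀ t : ℕ, 1 ≤ t → t ≤ T → 0 < t * v t + δ t := fun t h1 hT => by
    have := (second_moment_mem_Icc hγ0 hgb hβ hv0 hv t hT).1
    have := hδ t h1
    positivity
  have hδ1 := hδ 1 le_rfl
  have hinc := second_moment_increment hγ0 hγ1 hgb hβ hv0 hv
  induction n, hn1 using Nat.le_induction with
  | base =>
    have h := hinc 0 (by omega)
    simp only [zero_add, Nat.cast_zero, zero_mul, sub_zero] at h
    have hstep := potential_step (g := g 1) (m := x 1 ^ 2 / α - α / (γ * ((1 : ℕ) * v 1 + δ 1)))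
      hα hγ0 hαμ hδ1 (hs 1 le_rfl hnT) (le_refl (0 : ℝ))
      (by linarith [h.1]) (by linarith [h.2]) le_rfl
    have hx : δ 1 / (2 * α) * x 1 ^ 2 ≤ D ^ 2 * δ 1 / (2 * α) := by
      have hxD := abs_le.mp (hxb 1 (by simp; omega))
      have := mul_le_mul_of_nonneg_left (sq_le_sq' hxD.1 hxD.2)
        (by positivity : 0 ≤ δ 1 / (2 * α))
      calc _ ≤ _ := this
        _ = _ := by ring
    rw [Finset.Icc_self, Finset.sum_singleton, Real.log_div (hs 1 le_rfl hnT).ne' hδ1.ne']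
    linarith
  | succ n hn1 ih =>
    have ih := ih (by omega)
    have h := hinc n hnT
    have hmono := hδmono (n + 1) (by omega)
    rw [Nat.add_sub_cancel] at hmono
    have hstep := potential_step (g := g (n + 1)) hα hγ0 hαμ (hs n hn1 (by omega))
      (hs (n + 1) (by omega) hnT) (sub_nonpos.2 hmono) (by linarith [h.1]) (by linarith [h.2])
      (hm (n + 1) (by simp; omega))
    rw [Finset.sum_Icc_succ_top (by omega),
      Real.log_div (hs (n + 1) (by omega) hnT).ne' hδ1.ne']
    rw [Real.log_div (hs n hn1 (by omega)).ne' hδ1.ne'] at ih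
    linarith

/-- Pointwise form of the projected-step inequality; the last summand is the projection term. -/
theorem projected_step_coordinate {α t a g p q c : ℝ} (hα : 0 < α) (ht : 0 < t) (ha : 0 < a) :
    g * (p - c) ≤ t * a / (2 * α) * ((p - c) ^ 2 - (q - c) ^ 2) + α * g ^ 2 / (2 * (t * a))
      + t / α * (a * ((p - α / t * g / a) - q) * (c - q)) := by
  have h : t * a / (2 * α) * ((p - c) ^ 2 - (q - c) ^ 2) + α * g ^ 2 / (2 * (t * a))
      + t / α * (a * ((p - α / t * g / a) - q) * (c - q)) - g * (p - c)
      = t * a / (2 * α) * (p - α / t * g / a - q) ^ 2 := by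
    field_simp
    ring
  have : 0 ≤ t * a / (2 * α) * (p - α / t * g / a - q) ^ 2 := by positivity
  linarith

/-- Regret bound for SC-RMSProp (Theorem 12 in the paper). -/
theorem sc_rmsprop_regret
    (d T : ℕ) (hd : 1 ≤ d) (hT : 1 ≤ T)
    (γ : ℝ) (hγ0 : 0 < γ) (hγ1 : γ ≤ 1)
    (C : Set (Fin d → ℝ)) (hC : Convex ℝ C)
    (μ : Fin d → ℝ) (hμ : ∀ i, 0 < μ i)
    (Ginf Dinf α : ℝ) (hGinf : 0 < Ginf) (hDinf : 0 < Dinf)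
    (f : ℕ → (Fin d → ℝ) → ℝ)
    (θs : Fin d → ℝ) (hθs : θs ∈ C)
    (θ : ℕ → Fin d → ℝ) (hθC : ∀ t ∈ Finset.Icc 1 (T + 1), θ t ∈ C)
    (g : ℕ → Fin d → ℝ)
    (hsc : ∀ t ∈ Finset.Icc 1 T, ∀ y ∈ C,
      f t (θ t) + (∑ i, g t i * (y i - θ t i)) + ∑ i, μ i * (y i - θ t i) ^ 2 ≤ f t y)
    (hgb : ∀ t ∈ Finset.Icc 1 T, ∀ i, |g t i| ≤ Ginf)
    (hθb : ∀ t ∈ Finset.Icc 1 T, ∀ i, |θ t i - θs i| ≤ Dinf)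
    (β : ℕ → ℝ)
    (hβ : ∀ t : ℕ, 1 ≤ t → 1 - 1 / (t : ℝ) ≤ β t ∧ β t ≤ 1 - γ / (t : ℝ))
    (v : ℕ → Fin d → ℝ) (hv0 : ∀ i, v 0 i = 0)
    (hv : ∀ t : ℕ, 1 ≤ t → ∀ i, v t i = β t * v (t - 1) i + (1 - β t) * g t i ^ 2)
    (δ : ℕ → Fin d → ℝ)
    (hδ : ∀ t : ℕ, 1 ≤ t → ∀ i, 0 < δ t i ∧ δ t i ≤ 1)
    (hδmono : ∀ t : ℕ, 2 ≤ t → ∀ i, δ t i ≤ δ (t - 1) i)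
    (ε : ℕ → Fin d → ℝ) (hε : ∀ t i, ε t i = δ t i / (t : ℝ))
    (a : ℕ → Fin d → ℝ) (ha : ∀ t i, a t i = v t i + ε t i)
    (hα : ∀ i, (2 - γ) * Ginf ^ 2 / (2 * μ i) ≤ α)
    (hproj : ∀ t ∈ Finset.Icc 1 T, ∀ x ∈ C,
      ∑ i, a t i * ((θ t i - (α / (t : ℝ)) * g t i / a t i) - θ (t + 1) i)
          * (x i - θ (t + 1) i) ≤ 0) :
    ∑ t ∈ Finset.Icc 1 T, (f t (θ t) - f t θs)
      ≤ Dinf ^ 2 * (∑ i, δ 1 i) / (2 * α)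
        + (α / (2 * γ)) * ∑ i, Real.log (((T : ℝ) * v T i + δ T i) / δ 1 i)
        + (1 / 2) * ∑ i,
            ((Finset.Icc 1 T).inf' (Finset.nonempty_Icc.mpr hT)
                (fun t => (θ t i - θs i) ^ 2 / α
                  - α / (γ * ((t : ℝ) * v t i + (t : ℝ) * ε t i))))
              * (δ T i - δ 1 i)
        + (α / (2 * γ)) * ∑ i,
            (1 - γ) * (1 + Real.log (T : ℝ))
              / ((Finset.Icc 1 T).inf' (Finset.nonempty_Icc.mpr hT)
                  (fun j => (j : ℝ) * v j i + (j : ℝ) * ε j i)) := by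
  have hα0 : 0 < α := by
    have h : 0 < (2 - γ) * Ginf ^ 2 / (2 * μ ⟨0, hd⟩) := by
      have := hμ ⟨0, hd⟩
      have : 0 < 2 - γ := by linarith
      positivity
    exact h.trans_le (hα ⟨0, hd⟩)
  have hαμ : ∀ i, (2 - γ) * Ginf ^ 2 ≤ 2 * μ i * α := fun i => by
    have := hα i
    rw [div_le_iff₀ (by linarith [hμ i])] at this
    linarith
  have hv_nonneg : ∀ i, ∀ t ≤ T, 0 ≤ v t i := fun i t ht =>
    (second_moment_mem_Icc hγ0 (g := fun t => g t i) (v := fun t => v t i)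
      (fun t ht => hgb t ht i) hβ (hv0 i) (fun t ht => hv t ht i) t ht).1
  have hta : ∀ t : ℕ, 1 ≤ t → ∀ i, (t : ℝ) * v t i + t * ε t i = t * v t i + δ t i :=
    fun t ht i => by
      have : (t : ℝ) ≠ 0 := by positivity
      rw [hε, mul_div_cancel₀ _ this]
  have hs : ∀ t ∈ Finset.Icc 1 T, ∀ i, 0 < (t : ℝ) * v t i + δ t i := fun t ht i => by
    rw [Finset.mem_Icc] at ht
    have := hv_nonneg i t ht.2
    have := (hδ t ht.1 i).1
    positivity
  have hround : ∀ t ∈ Finset.Icc 1 T, f t (θ t) - f t θs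
      ≤ ∑ i, ((t * v t i + δ t i) / (2 * α) * ((θ t i - θs i) ^ 2 - (θ (t + 1) i - θs i) ^ 2)
        + α * g t i ^ 2 / (2 * (t * v t i + δ t i)) - μ i * (θ t i - θs i) ^ 2) := by
    intro t ht
    have ht1 := (Finset.mem_Icc.mp ht).1
    have ht0 : (0 : ℝ) < t := by positivity
    have hta' : ∀ i, t * a t i = t * v t i + δ t i := fun i => by
      rw [ha, mul_add, hta t ht1 i]
    have hP := mul_nonpos_of_nonneg_of_nonpos (by positivity : 0 ≤ (t : ℝ) / α)
      (hproj t ht θs hθs)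
    have hsum := Finset.sum_le_sum fun i (_ : i ∈ Finset.univ) =>
      projected_step_coordinate (g := g t i) (p := θ t i) (q := θ (t + 1) i) (c := θs i) hα0 ht0
        (pos_of_mul_pos_right ((hta' i).symm ▸ hs t ht i) ht0.le)
    have hlin : ∑ i, g t i * (θs i - θ t i) = -∑ i, g t i * (θ t i - θs i) := by
      rw [← Finset.sum_neg_distrib]
      exact Finset.sum_congr rfl fun i _ => by ring
    have hquad : ∑ i, μ i * (θs i - θ t i) ^ 2 = ∑ i, μ i * (θ t i - θs i) ^ 2 :=
      Finset.sum_congr rfl fun i _ => by ring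
    have hf := hsc t ht θs hθs
    simp only [Finset.sum_add_distrib, ← Finset.mul_sum, hta'] at hsum
    rw [Finset.sum_sub_distrib, Finset.sum_add_distrib]
    linarith
  have hlast : 0 ≤ (α / (2 * γ)) * ∑ i,
      (1 - γ) * (1 + Real.log (T : ℝ))
        / ((Finset.Icc 1 T).inf' (Finset.nonempty_Icc.mpr hT)
            (fun j => (j : ℝ) * v j i + (j : ℝ) * ε j i)) := by
    refine mul_nonneg (by positivity) (Finset.sum_nonneg fun i _ => div_nonneg ?_ ?_)
    · exact mul_nonneg (by linarith)
        (by linarith [Real.log_nonneg (by exact_mod_cast hT : (1 : ℝ) ≤ T)])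
    · refine Finset.le_inf' _ _ fun j hj => ?_
      rw [hta j (Finset.mem_Icc.mp hj).1]
      exact (hs j hj i).le
  refine (Finset.sum_le_sum hround).trans (le_add_of_le_of_nonneg ?_ hlast)
  rw [Finset.sum_comm, Finset.mul_sum, Finset.sum_div, Finset.mul_sum, Finset.mul_sum,
    ← Finset.sum_add_distrib, ← Finset.sum_add_distrib]
  refine Finset.sum_le_sum fun i _ => ?_
  have hcoord := coordinate_regret_le (x := fun t => θ t i - θs i) (g := fun t => g t i)
    (v := fun t => v t i) (δ := fun t => δ t i)
    (m := (Finset.Icc 1 T).inf' (Finset.nonempty_Icc.mpr hT)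
      (fun t => (θ t i - θs i) ^ 2 / α - α / (γ * ((t : ℝ) * v t i + (t : ℝ) * ε t i))))
    hγ0 hγ1 hα0 (hαμ i) (fun t ht => hgb t ht i) (fun t ht => hθb t ht i) hβ (hv0 i)
    (fun t ht => hv t ht i) (fun t ht => (hδ t ht i).1) (fun t ht => hδmono t ht i)
    (fun t ht => by
      rw [← hta t (Finset.mem_Icc.mp ht).1 i]
      exact Finset.inf'_le _ ht)
    T hT le_rfl
  have hboundary : 0 ≤ (T * v T i + δ T i) / (2 * α) * (θ (T + 1) i - θs i) ^ 2 := by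
    have := hs T (Finset.mem_Icc.mpr ⟨hT, le_rfl⟩) i
    positivity
  linarith
end
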